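/- arXiv:math/0206297 — 3 statements merged into one kernel-verified Lean document; each statement's English description precedes it below -/
import Mathlib

section
/- Let k be a field of characteristic zero, A a finitely generated commutative k-algebra, G a finite group acting on A by k-algebra automorphisms, and M a finitely generated G-equivariant A-module. Then M descends to Spec A^G if and only if for every maximal ideal m of A, both M ⊗_A A/m and Tor_1^A(M, A/m) are generated as A/m-modules by elements fixed by the stabilizer G_m. -/
/-!
STATEMENT 0 (Theorem "firstprop", affine finite-group case, conditions
(1) ⟺ (2)): for a field `k` of characteristic zero, a finitely generated
commutative `k`-algebra `A`, a finite group `G` acting on `A` by `k`-algebra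
automorphisms, and a finitely generated `G`-equivariant `A`-module `M`,
the module `M` descends to `Spec Aᴳ` if and only if for every maximal ideal
`m` of `A` both `M ⊗[A] A/m` and `Tor₁ᴬ(M, A/m)` are generated (as
`A/m`-modules) by elements fixed by the stabilizer `G_m`.

Conventions used below:
* The fiber `M ⊗[A] A/m` is realized as `M/mM`; "the class of `y` is fixed by
  `g`" becomes `g • y - y ∈ m • ⊤`, and "`M/mM` is generated by `G_m`-fixed
  elements" becomes `Submodule.span A {y | class of y is G_m-fixed} = ⊤`.
* `Tor₁ᴬ(M, A/m)` is realized as the kernel of the multiplication map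
  `m ⊗[A] M → M` (tensor `0 → m → A → A/m → 0` with `M`); the action of a
  stabilizer element `g ∈ G_m` on it is `torSmul`, and generation by fixed
  elements is expressed via `Submodule.span A` (the kernel is killed by `m`,
  so `A`-generation and `A/m`-generation agree).
-/

open TensorProduct

universe u v

/-- The invariant subalgebra `Aᴳ` of the `G`-action on the `k`-algebra `A`. -/
def invAlg (k : Type*) (A : Type u) (G : Type*) [CommSemiring k] [CommRing A]
    [Algebra k A] [Group G] [MulSemiringAction G A] [SMulCommClass G k A] :
    Subalgebra k A where
  carrier := {a | ∀ g : G, g • a = a}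
  mul_mem' := fun ha hb g => by rw [smul_mul', ha g, hb g]
  add_mem' := fun ha hb g => by rw [smul_add, ha g, hb g]
  algebraMap_mem' := fun c g => by
    rw [Algebra.algebraMap_eq_smul_one, smul_comm, smul_one]

/-- A `G`-equivariant `A`-module `M` *descends to `Spec Aᴳ`* if there are an
`Aᴳ`-module `Q` and a `G`-equivariant `A`-linear isomorphism
`A ⊗[Aᴳ] Q ≃ M`, where `G` acts on `A ⊗[Aᴳ] Q` through the factor `A`. -/
def Descends (k : Type*) (A : Type u) (G : Type*) [Field k] [CommRing A]
    [Algebra k A] [Group G] [MulSemiringAction G A] [SMulCommClass G k A]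
    (M : Type v) [AddCommGroup M] [Module A M] [DistribMulAction G M] : Prop :=
  ∃ (Q : Type v) (_ : AddCommGroup Q) (_ : Module (invAlg k A G) Q)
    (e : (A ⊗[invAlg k A G] Q) ≃ₗ[A] M),
      ∀ (g : G) (a : A) (q : Q), e ((g • a) ⊗ₜ q) = g • e (a ⊗ₜ q)

/-- The multiplication map `m ⊗[A] M →ₗ[A] M`.  Its kernel is the standard
model for `Tor₁ᴬ(M, A/m)` (tensor the exact sequence `0 → m → A → A/m → 0`
with `M` and use `Tor₁ᴬ(M, A) = 0`). -/
noncomputable def torMul (A : Type u) [CommRing A] (M : Type v) [AddCommGroup M]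
    [Module A M] (m : Ideal A) : (m ⊗[A] M) →ₗ[A] M :=
  TensorProduct.lift ((LinearMap.lsmul A M).comp m.subtype)

/-- The additive (semilinear) endomorphism of `m ⊗[A] M` induced by a ring
endomorphism `σ` of `A` preserving `m` together with a `σ`-semilinear additive
endomorphism `τ` of `M`; for `σ`, `τ` given by the action of a stabilizer
element `g ∈ G_m` this is the action of `g` on `m ⊗[A] M`, i.e. on
`Tor₁ᴬ(M, A/m)` by functoriality. -/
noncomputable def torSmul {A : Type u} [CommRing A] {M : Type v} [AddCommGroup M]
    [Module A M] (σ : A →+* A) (τ : M →+ M)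
    (hτ : ∀ (a : A) (x : M), τ (a • x) = σ a • τ x)
    (m : Ideal A) (hm : ∀ a ∈ m, σ a ∈ m) :
    (m ⊗[A] M) →+ (m ⊗[A] M) :=
  TensorProduct.liftAddHom
    { toFun := fun x =>
        { toFun := fun y => (⟨σ (x : A), hm _ x.2⟩ : m) ⊗ₜ[A] (τ y)
          map_zero' := by simp
          map_add' := fun y z => by simp [TensorProduct.tmul_add] }
      map_zero' := by
        have h : (⟨σ ((0 : m) : A), hm _ (0 : m).2⟩ : m) = 0 := Subtype.ext (by simp)
        ext y
        simp only [AddMonoidHom.coe_mk, ZeroHom.coe_mk, AddMonoidHom.zero_apply, h,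
          TensorProduct.zero_tmul]
      map_add' := fun x x' => by
        have h : (⟨σ ((x + x' : m) : A), hm _ (x + x').2⟩ : m)
            = ⟨σ (x : A), hm _ x.2⟩ + ⟨σ (x' : A), hm _ x'.2⟩ := Subtype.ext (by simp)
        ext y
        simp only [AddMonoidHom.coe_mk, ZeroHom.coe_mk, AddMonoidHom.add_apply, h,
          TensorProduct.add_tmul] }
    (fun a x y => by
      have h1 : (⟨σ ((a • x : m) : A), hm _ (a • x).2⟩ : m)
          = σ a • (⟨σ (x : A), hm _ x.2⟩ : m) :=
        Subtype.ext (by simp [smul_eq_mul, map_mul])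
      simp only [AddMonoidHom.coe_mk, ZeroHom.coe_mk]
      rw [h1, TensorProduct.smul_tmul, hτ])


/-- Nakayama over all maximal ideals. -/
lemma aux_nakayama {A : Type*} [CommRing A] {N : Type*} [AddCommGroup N] [Module A N]
    [Module.Finite A N] (S : Submodule A N)
    (h : ∀ m : Ideal A, m.IsMaximal → S ⊔ m • (⊤ : Submodule A N) = ⊤) : S = ⊤ := by
  have key : Module.annihilator A (N ⧸ S) = ⊤ := by
    by_contra hne
    obtain ⟨m, hm, hle⟩ := Ideal.exists_le_maximal _ hne
    have h1 : (⊤ : Submodule A (N ⧸ S)) ≤ m • ⊤ := by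
      have := congrArg (Submodule.map S.mkQ) (h m hm)
      rw [Submodule.map_sup, Submodule.map_smul'', Submodule.map_top, Submodule.range_mkQ,
        Submodule.mkQ_map_self, bot_sup_eq] at this
      exact this.ge
    obtain ⟨r, hr1, hr2⟩ := Submodule.exists_sub_one_mem_and_smul_eq_zero_of_fg_of_le_smul m _
      (Module.Finite.fg_top (R := A) (M := N ⧸ S)) h1
    have hr : r ∈ m := hle (Module.mem_annihilator.mpr fun x => hr2 x trivial)
    apply hm.ne_top
    rw [Ideal.eq_top_iff_one]
    have := m.sub_mem hr hr1
    simpa using this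
  rw [Module.annihilator_eq_top_iff] at key
  exact Submodule.Quotient.subsingleton_iff.mp key

open Classical in
/-- Key lemma, via independence of characters. -/
lemma aux_key {A : Type*} [CommRing A] {N : Type*} [AddCommGroup N] [Module A N]
    (m : Ideal A) (hm : m.IsMaximal) (hA : ∀ n : ℕ, n ≠ 0 → (n : A) ∉ m)
    {H : Type*} [Fintype H] (h0 : H) (χ : H → A →* A) (ρ : H → N → N)
    (hρ : ∀ h a x, ρ h (a • x) = χ h a • ρ h x) (S : Submodule A N)
    (hmS : m • (⊤ : Submodule A N) ≤ S) (hsum : ∀ t, ∑ h, ρ h t ∈ S)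
    (hI : ∀ h, (∀ a, χ h a - a ∈ m) → ∀ t, ρ h t - t ∈ S)
    (h0I : ∀ a, χ h0 a - a ∈ m) : S = ⊤ := by
  rw [Submodule.eq_top_iff']
  intro t
  let _ : Field (A ⧸ m) := Ideal.Quotient.field m
  have htors : Module.IsTorsionBySet A (N ⧸ S) m := by
    rintro x ⟨a, ha⟩
    obtain ⟨y, rfl⟩ := S.mkQ_surjective x
    change a • S.mkQ y = 0
    rw [← map_smul, Submodule.mkQ_apply, Submodule.Quotient.mk_eq_zero]
    exact hmS (Submodule.smul_mem_smul ha trivial)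
  let _ : Module (A ⧸ m) (N ⧸ S) := htors.module
  rw [← Submodule.Quotient.mk_eq_zero, ← Module.forall_dual_apply_eq_zero_iff (A ⧸ m)]
  intro f
  let φ : N → A ⧸ m := fun x => f (S.mkQ x)
  have φadd : ∀ x y, φ (x - y) = φ x - φ y := fun x y => by simp [φ]
  have φsum : ∀ (s : Finset H) (x : H → N), φ (∑ i ∈ s, x i) = ∑ i ∈ s, φ (x i) := fun s x => by
    simp only [φ, map_sum]
  have φsmul : ∀ (a : A) x, φ (a • x) = Ideal.Quotient.mk m a * φ x := fun a x => by
    have e1 : S.mkQ (a • x) = Ideal.Quotient.mk m a • S.mkQ x := rfl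
    simp only [φ]
    rw [e1, map_smul, smul_eq_mul]
  have φS : ∀ x ∈ S, φ x = 0 := fun x hx => by
    simp only [φ, Submodule.mkQ_apply]
    rw [(Submodule.Quotient.mk_eq_zero S).mpr hx, map_zero]
  change φ t = 0
  let ψ : H → (A →* A ⧸ m) := fun h => (Ideal.Quotient.mk m : A →* A ⧸ m).comp (χ h)
  have hli := linearIndependent_monoidHom A (A ⧸ m)
  rw [linearIndependent_iff'] at hli
  have h1 := hli (Finset.univ.image ψ) (fun p => ∑ h with ψ h = p, φ (ρ h t)) (by
    ext a
    have h2 : ∑ h, ψ h a * φ (ρ h t) = 0 := by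
      have := φS _ (hsum (a • t))
      rw [φsum] at this
      simp only [hρ, φsmul] at this
      exact this
    rw [Finset.sum_apply, Pi.zero_apply, ← h2,
      ← Finset.sum_fiberwise_of_maps_to (s := Finset.univ) (t := Finset.univ.image ψ) (g := ψ)
        (fun h _ => Finset.mem_image_of_mem _ (Finset.mem_univ _))]
    refine Finset.sum_congr rfl fun p _ => ?_
    rw [Pi.smul_apply, smul_eq_mul, Finset.sum_mul]
    refine Finset.sum_congr rfl fun h hh => ?_
    rw [← (Finset.mem_filter.mp hh).2, mul_comm]) (ψ h0)
    (Finset.mem_image_of_mem _ (Finset.mem_univ _))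
  have h3 : ∀ h ∈ Finset.univ.filter (fun h => ψ h = ψ h0), φ (ρ h t) = φ t := by
    intro h hh
    have hh' := (Finset.mem_filter.mp hh).2
    rw [← sub_eq_zero, ← φadd]
    apply φS
    apply hI
    intro a
    have e1 : Ideal.Quotient.mk m (χ h a) = Ideal.Quotient.mk m (χ h0 a) :=
      DFunLike.congr_fun hh' a
    rw [← Ideal.Quotient.eq, e1, Ideal.Quotient.eq]
    exact h0I a
  rw [Finset.sum_congr rfl h3, Finset.sum_const, nsmul_eq_mul] at h1
  refine (mul_eq_zero.mp h1).resolve_left ?_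
  rw [← map_natCast (Ideal.Quotient.mk m), Ideal.Quotient.eq_zero_iff_mem]
  apply hA
  rw [Finset.card_ne_zero]
  exact ⟨h0, by simp⟩

section AuxTor

variable {A : Type u} [CommRing A] {M : Type v} [AddCommGroup M] [Module A M]

lemma aux_torSmul_tmul (σ : A →+* A) (τ : M →+ M)
    (hτ : ∀ (a : A) (x : M), τ (a • x) = σ a • τ x)
    (m : Ideal A) (hm : ∀ a ∈ m, σ a ∈ m) (a : m) (x : M) :
    torSmul σ τ hτ m hm (a ⊗ₜ x) = (⟨σ a, hm _ a.2⟩ : m) ⊗ₜ[A] τ x := rfl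

lemma aux_torMul_tmul (m : Ideal A) (a : m) (x : M) :
    torMul A M m (a ⊗ₜ x) = (a : A) • x := rfl

lemma aux_torSmul_smul (σ : A →+* A) (τ : M →+ M)
    (hτ : ∀ (a : A) (x : M), τ (a • x) = σ a • τ x)
    (m : Ideal A) (hm : ∀ a ∈ m, σ a ∈ m) (b : A) (t : m ⊗[A] M) :
    torSmul σ τ hτ m hm (b • t) = σ b • torSmul σ τ hτ m hm t := by
  induction t with
  | zero => simp
  | add s t hs ht => rw [smul_add, map_add, map_add, smul_add, hs, ht]
  | tmul a x =>
    rw [← TensorProduct.tmul_smul, aux_torSmul_tmul, aux_torSmul_tmul, hτ,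
      TensorProduct.tmul_smul]

lemma aux_torMul_torSmul (σ : A →+* A) (τ : M →+ M)
    (hτ : ∀ (a : A) (x : M), τ (a • x) = σ a • τ x)
    (m : Ideal A) (hm : ∀ a ∈ m, σ a ∈ m) (t : m ⊗[A] M) :
    torMul A M m (torSmul σ τ hτ m hm t) = τ (torMul A M m t) := by
  induction t with
  | zero => simp
  | add s t hs ht => rw [map_add, map_add, map_add, map_add, hs, ht]
  | tmul a x => rw [aux_torSmul_tmul, aux_torMul_tmul, aux_torMul_tmul, hτ]

lemma aux_smul_eq (m : Ideal A) (b : m) (t : m ⊗[A] M) :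
    (b : A) • t = b ⊗ₜ[A] torMul A M m t := by
  induction t with
  | zero => simp
  | add s t hs ht => rw [smul_add, map_add, TensorProduct.tmul_add, hs, ht]
  | tmul a x =>
    rw [aux_torMul_tmul, TensorProduct.tmul_smul, TensorProduct.smul_tmul',
      TensorProduct.smul_tmul']
    congr 1
    ext
    simp [mul_comm]

lemma aux_smul_ker (m : Ideal A) {b : A} (hb : b ∈ m) {t : m ⊗[A] M}
    (ht : torMul A M m t = 0) : b • t = 0 := by
  have := aux_smul_eq m ⟨b, hb⟩ t
  rwa [ht, TensorProduct.tmul_zero] at this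

variable {G : Type*} [Group G] [MulSemiringAction G A] [DistribMulAction G M]

/-- the action of a stabilizer element -/
noncomputable abbrev auxT (hGM : ∀ (g : G) (a : A) (x : M), g • (a • x) = (g • a) • (g • x))
    (m : Ideal A) (g : G) (hg : ∀ a : A, g • a ∈ m ↔ a ∈ m) : (m ⊗[A] M) →+ (m ⊗[A] M) :=
  torSmul (MulSemiringAction.toRingHom G A g) (DistribMulAction.toAddMonoidHom M g)
    (fun a x => hGM g a x) m (fun a ha => (hg a).mpr ha)

lemma auxT_tmul (hGM : ∀ (g : G) (a : A) (x : M), g • (a • x) = (g • a) • (g • x))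
    (m : Ideal A) (g : G) (hg : ∀ a : A, g • a ∈ m ↔ a ∈ m) (a : m) (x : M) :
    auxT hGM m g hg (a ⊗ₜ x) = (⟨g • (a : A), (hg a).mpr a.2⟩ : m) ⊗ₜ[A] (g • x) := rfl

lemma auxT_smul (hGM : ∀ (g : G) (a : A) (x : M), g • (a • x) = (g • a) • (g • x))
    (m : Ideal A) (g : G) (hg : ∀ a : A, g • a ∈ m ↔ a ∈ m) (b : A) (t : m ⊗[A] M) :
    auxT hGM m g hg (b • t) = (g • b) • auxT hGM m g hg t :=
  aux_torSmul_smul _ _ _ _ _ _ _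

lemma auxT_mul (hGM : ∀ (g : G) (a : A) (x : M), g • (a • x) = (g • a) • (g • x))
    (m : Ideal A) (g h : G) (hg : ∀ a : A, g • a ∈ m ↔ a ∈ m)
    (hh : ∀ a : A, h • a ∈ m ↔ a ∈ m) (hgh : ∀ a : A, (g * h) • a ∈ m ↔ a ∈ m)
    (t : m ⊗[A] M) :
    auxT hGM m g hg (auxT hGM m h hh t) = auxT hGM m (g * h) hgh t := by
  induction t with
  | zero => simp
  | add s t hs ht => rw [map_add, map_add, map_add, hs, ht]
  | tmul a x => simp only [auxT_tmul, mul_smul]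

lemma auxT_ker (hGM : ∀ (g : G) (a : A) (x : M), g • (a • x) = (g • a) • (g • x))
    (m : Ideal A) (g : G) (hg : ∀ a : A, g • a ∈ m ↔ a ∈ m) {t : m ⊗[A] M}
    (ht : torMul A M m t = 0) : torMul A M m (auxT hGM m g hg t) = 0 :=
  (aux_torMul_torSmul _ _ _ _ _ t).trans (by rw [ht, map_zero])

/-- inertia elements stabilize -/
lemma aux_inertia_stab (m : Ideal A) (g : G) (hg : ∀ a : A, g • a - a ∈ m) (a : A) :
    g • a ∈ m ↔ a ∈ m :=
  ⟨fun h => by simpa using m.sub_mem h (hg a), fun h => by simpa using m.add_mem (hg a) h⟩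

/-- If inertia acts trivially on Tor, then Tor is generated by stabilizer invariants. -/
lemma aux_tor_generated [Finite G]
    (hGM : ∀ (g : G) (a : A) (x : M), g • (a • x) = (g • a) • (g • x))
    (m : Ideal A) (hm : m.IsMaximal) (hA : ∀ n : ℕ, n ≠ 0 → (n : A) ∉ m)
    (hI : ∀ (g : G) (hg : ∀ a : A, g • a - a ∈ m) (t : m ⊗[A] M), torMul A M m t = 0 →
      auxT hGM m g (aux_inertia_stab m g hg) t = t)
    (t : m ⊗[A] M) (ht : torMul A M m t = 0) :
    t ∈ Submodule.span A {t' : m ⊗[A] M | torMul A M m t' = 0 ∧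
      ∀ (g : G) (hg : ∀ a : A, g • a ∈ m ↔ a ∈ m), auxT hGM m g hg t' = t'} := by
  classical
  let H : Subgroup G :=
    { carrier := {g | ∀ a : A, g • a ∈ m ↔ a ∈ m}
      one_mem' := fun a => by rw [one_smul]
      mul_mem' := fun {g h} hg hh a => by rw [mul_smul, hg, hh]
      inv_mem' := fun {g} hg a => by rw [← hg, smul_inv_smul] }
  have : Fintype H := Fintype.ofFinite H
  set S := Submodule.span A {t' : m ⊗[A] M | torMul A M m t' = 0 ∧
      ∀ (g : G) (hg : ∀ a : A, g • a ∈ m ↔ a ∈ m), auxT hGM m g hg t' = t'} with hS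
  let N := LinearMap.ker (torMul A M m)
  have key := aux_key (N := N) m hm hA (H := H) 1
    (fun h => (MulSemiringAction.toRingHom G A h : A →* A))
    (fun h x => ⟨auxT hGM m h h.2 x, auxT_ker hGM m h h.2 x.2⟩)
    (fun h a x => Subtype.ext (auxT_smul hGM m h h.2 a x))
    (S.comap N.subtype)
    (by
      rw [Submodule.smul_le]
      rintro a ha ⟨x, hx⟩ -
      change a • x ∈ S
      rw [aux_smul_ker m ha hx]
      exact S.zero_mem)
    (by
      rintro ⟨x, hx⟩
      rw [Submodule.mem_comap, map_sum]
      change ∑ h : H, auxT hGM m h h.2 x ∈ S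
      apply Submodule.subset_span
      refine ⟨?_, ?_⟩
      · rw [map_sum]
        exact Finset.sum_eq_zero fun h _ => auxT_ker hGM m h h.2 hx
      · intro g hg
        rw [map_sum]
        refine Fintype.sum_equiv (Equiv.mulLeft (⟨g, hg⟩ : H)) _ _ fun h => ?_
        exact auxT_mul hGM m g h hg h.2 _ x)
    (by
      rintro h hh ⟨x, hx⟩
      change auxT hGM m h h.2 x - x ∈ S
      have := hI h hh x hx
      rw [this, sub_self]
      exact S.zero_mem)
    (by intro a; simp)
  have h2 : (⟨t, ht⟩ : N) ∈ S.comap N.subtype := by rw [key]; trivial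
  exact h2

end AuxTor

/-- Forward direction: inertia acts trivially on Tor of a descended module. -/
lemma aux_forward_inertia (k : Type*) [Field k]
    {A : Type u} [CommRing A] [Algebra k A]
    {G : Type*} [Group G] [MulSemiringAction G A] [SMulCommClass G k A]
    {M : Type v} [AddCommGroup M] [Module A M] [DistribMulAction G M]
    (hGM : ∀ (g : G) (a : A) (x : M), g • (a • x) = (g • a) • (g • x))
    {Q : Type v} [AddCommGroup Q] [Module (invAlg k A G) Q]
    (e : (A ⊗[invAlg k A G] Q) ≃ₗ[A] M)
    (he : ∀ (g : G) (a : A) (q : Q), e ((g • a) ⊗ₜ q) = g • e (a ⊗ₜ q))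
    (m : Ideal A) (g : G) (hg : ∀ a : A, g • a - a ∈ m) (t : m ⊗[A] M)
    (ht : torMul A M m t = 0) :
    auxT hGM m g (aux_inertia_stab m g hg) t = t := by
  have hinv : ∀ q : Q, g • e (1 ⊗ₜ q) = e (1 ⊗ₜ q) := fun q => by
    rw [← he, smul_one]
  have hbq : ∀ (b : invAlg k A G) (q : Q), e (1 ⊗ₜ (b • q)) = (b : A) • e (1 ⊗ₜ q) := by
    intro b q
    rw [← map_smul, ← TensorProduct.smul_tmul, TensorProduct.smul_tmul']
    rfl
  let D : (A ⊗[invAlg k A G] Q) →+ (m ⊗[A] M) := TensorProduct.liftAddHom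
    (AddMonoidHom.mk' (fun a => AddMonoidHom.mk'
      (fun q => (⟨g • a - a, hg a⟩ : m) ⊗ₜ[A] e (1 ⊗ₜ q))
      (fun q q' => by rw [TensorProduct.tmul_add, map_add, TensorProduct.tmul_add]))
      (fun a a' => by
        ext q
        simp only [AddMonoidHom.mk'_apply, AddMonoidHom.add_apply]
        rw [← TensorProduct.add_tmul]
        congr 1
        ext
        simp only [smul_add, Submodule.coe_add]
        ring))
    (fun b a q => by
      simp only [AddMonoidHom.mk'_apply]
      rw [hbq, TensorProduct.tmul_smul, TensorProduct.smul_tmul']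
      congr 1
      ext
      simp only [Subalgebra.smul_def, smul_eq_mul, smul_mul', b.2 g, Submodule.coe_smul]
      ring)
  have hD : ∀ (a : A) (q : Q), D (a ⊗ₜ q) = (⟨g • a - a, hg a⟩ : m) ⊗ₜ[A] e (1 ⊗ₜ q) :=
    fun a q => rfl
  have key : ∀ t : m ⊗[A] M,
      auxT hGM m g (aux_inertia_stab m g hg) t - t = D (e.symm (torMul A M m t)) := by
    intro t
    induction t with
    | zero => simp
    | add s t hs ht => rw [map_add, map_add, map_add, map_add, ← hs, ← ht]; abel
    | tmul a x =>
      obtain ⟨z, rfl⟩ := e.surjective x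
      induction z with
      | zero => simp
      | add s t hs ht =>
        rw [map_add, TensorProduct.tmul_add, map_add, map_add, map_add, map_add, ← hs, ← ht]
        abel
      | tmul b q =>
        have hb : (b ⊗ₜ[invAlg k A G] q : A ⊗[invAlg k A G] Q) = b • (1 ⊗ₜ q) := by
          rw [TensorProduct.smul_tmul', smul_eq_mul, mul_one]
        rw [aux_torMul_tmul, map_smul, e.symm_apply_apply, TensorProduct.smul_tmul', hD,
          auxT_tmul, hb, map_smul, hGM, hinv, TensorProduct.tmul_smul, TensorProduct.tmul_smul,
          TensorProduct.smul_tmul', TensorProduct.smul_tmul', ← TensorProduct.sub_tmul]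
        congr 1
        ext
        simp only [smul_eq_mul, smul_mul', Submodule.coe_smul, Submodule.coe_sub]
        ring
  have := key t
  rw [ht, map_zero, map_zero, sub_eq_zero] at this
  exact this

section AuxReverse

variable {A : Type u} [CommRing A] {G : Type*} [Group G] [Finite G] [MulSemiringAction G A]

/-- A finite equivariant module on whose fibers inertia acts trivially is generated by
invariants; here `N` is a stable submodule of `F`. -/
lemma aux_generated {F : Type*} [AddCommGroup F] [Module A F] [DistribMulAction G F]
    (hGF : ∀ (g : G) (a : A) (x : F), g • (a • x) = (g • a) • (g • x))
    (hA : ∀ n : ℕ, n ≠ 0 → IsUnit (n : A))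
    (N : Submodule A F) (hN : N.FG) (hst : ∀ (g : G), ∀ x ∈ N, g • x ∈ N)
    (hI : ∀ m : Ideal A, m.IsMaximal → ∀ g : G, (∀ a : A, g • a - a ∈ m) →
      ∀ x ∈ N, g • x - x ∈ m • N) :
    N ≤ Submodule.span A {x | x ∈ N ∧ ∀ g : G, g • x = x} := by
  have : Fintype G := Fintype.ofFinite G
  have : Module.Finite A N := Module.Finite.iff_fg.mpr hN
  set S := Submodule.span A {x | x ∈ N ∧ ∀ g : G, g • x = x} with hS
  have hsm : ∀ m : Ideal A, (m • (⊤ : Submodule A N)).map N.subtype = m • N := by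
    intro m
    rw [Submodule.map_smul'', Submodule.map_top, Submodule.range_subtype]
  have key : S.comap N.subtype = ⊤ := by
    apply aux_nakayama
    intro m hm
    refine aux_key (N := N) m hm ?_ (H := G) 1
      (fun h => (MulSemiringAction.toRingHom G A h : A →* A))
      (fun h x => ⟨h • (x : F), hst h x x.2⟩)
      (fun h a x => Subtype.ext (hGF h a x)) _ le_sup_right ?_ ?_ ?_
    · intro n hn hmem
      exact hm.ne_top (Ideal.eq_top_of_isUnit_mem _ hmem (hA n hn))
    · rintro ⟨x, hx⟩
      apply Submodule.mem_sup_left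
      rw [Submodule.mem_comap, map_sum]
      change ∑ h : G, h • x ∈ S
      refine Submodule.subset_span ⟨N.sum_mem fun h _ => hst h x hx, fun g => ?_⟩
      rw [Finset.smul_sum]
      exact Fintype.sum_equiv (Equiv.mulLeft g) _ _ fun h => by simp [mul_smul]
    · rintro h hh ⟨x, hx⟩
      apply Submodule.mem_sup_right
      have h1 := hI m hm h hh x hx
      rw [← hsm, Submodule.mem_map] at h1
      obtain ⟨y, hy, hyx⟩ := h1
      convert hy using 1
      exact Subtype.ext hyx.symm
    · intro a; simp
  intro x hx
  have h2 : (⟨x, hx⟩ : N) ∈ S.comap N.subtype := by rw [key]; trivial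
  exact h2

lemma aux_inertia_pow (m : Ideal A) (g : G) (hg : ∀ a : A, g • a - a ∈ m) (i : ℕ) (a : A) :
    g ^ i • a - a ∈ m := by
  induction i with
  | zero => simp
  | succ i ih =>
    have := m.add_mem (hg (g ^ i • a)) ih
    rw [pow_succ', mul_smul]
    simpa using this

variable {M : Type v} [AddCommGroup M] [Module A M] [DistribMulAction G M]

/-- inertia acts trivially on `K/mK`, with `K` the module of relations of invariant
generators `x`. -/
lemma aux_relations (hGM : ∀ (g : G) (a : A) (x : M), g • (a • x) = (g • a) • (g • x))
    (hA : ∀ n : ℕ, n ≠ 0 → IsUnit (n : A)) {ι : Type*} [Fintype ι] (x : ι → M)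
    (hx : ∀ (g : G) i, g • x i = x i) (hspan : Submodule.span A (Set.range x) = ⊤)
    (m : Ideal A)
    (hTor : ∀ t : m ⊗[A] M, torMul A M m t = 0 →
      t ∈ Submodule.span A {t' : m ⊗[A] M | torMul A M m t' = 0 ∧
      ∀ (g : G) (hg : ∀ a : A, g • a ∈ m ↔ a ∈ m), auxT hGM m g hg t' = t'})
    (g : G) (hg : ∀ a : A, g • a - a ∈ m)
    (c : ι → A) (hc : c ∈ LinearMap.ker (Fintype.linearCombination A x)) :
    g • c - c ∈ m • LinearMap.ker (Fintype.linearCombination A x) := by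
  set K := LinearMap.ker (Fintype.linearCombination A x) with hK
  have memK : ∀ d : ι → A, d ∈ K ↔ ∑ i, d i • x i = 0 := fun d => by
    rw [hK, LinearMap.mem_ker, Fintype.linearCombination_apply]
  have hst : ∀ (g : G), ∀ d ∈ K, g • d ∈ K := by
    intro g d hd
    rw [memK] at hd ⊢
    have := congrArg (g • ·) hd
    simpa [Finset.smul_sum, hGM, hx] using this
  have claim2 : ∀ (g : G) (_ : ∀ a : A, g • a - a ∈ m) (d : ι → A), d ∈ K → (∀ i, d i ∈ m) →
      g • d - d ∈ m • K := by
    intro g hg d hd hdm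
    have hfix : ∀ t ∈ Submodule.span A {t' : m ⊗[A] M | torMul A M m t' = 0 ∧
        ∀ (g : G) (hg : ∀ a : A, g • a ∈ m ↔ a ∈ m), auxT hGM m g hg t' = t'},
        auxT hGM m g (aux_inertia_stab m g hg) t = t ∧ torMul A M m t = 0 := by
      intro t ht
      induction ht using Submodule.span_induction with
      | mem t ht => exact ⟨ht.2 _ _, ht.1⟩
      | zero => simp
      | add s t _ _ hs ht =>
        exact ⟨by rw [map_add, hs.1, ht.1], by rw [map_add, hs.2, ht.2, add_zero]⟩
      | smul a t _ ht =>
        refine ⟨?_, by rw [map_smul, ht.2, smul_zero]⟩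
        have e1 : g • a = (g • a - a) + a := by ring
        rw [auxT_smul, ht.1, e1, add_smul, aux_smul_ker m (hg a) ht.2, zero_add]
    have h1 := hfix (∑ i, (⟨d i, hdm i⟩ : m) ⊗ₜ[A] x i) (hTor _ (by
      rw [map_sum]
      exact (memK d).mp hd))
    have h2 : ∑ i, x i ⊗ₜ[A] (⟨g • d i - d i, hg _⟩ : m) = 0 := by
      have h3 := h1.1
      rw [map_sum, ← sub_eq_zero, ← Finset.sum_sub_distrib] at h3
      have h4 := congrArg (TensorProduct.comm A m M) h3
      rw [map_zero, map_sum] at h4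
      rw [← h4]
      refine Finset.sum_congr rfl fun i _ => ?_
      rw [auxT_tmul, hx, ← TensorProduct.sub_tmul, TensorProduct.comm_tmul]
      rfl
    obtain ⟨n, a, y, hy, ha⟩ := TensorProduct.vanishesTrivially_of_sum_tmul_eq_zero A hspan h2
    have h5 : g • d - d = ∑ j, (y j : A) • (fun i => a i j) := by
      ext i
      have := congrArg (Subtype.val) (hy i)
      simp only [Submodule.coe_sum, Submodule.coe_smul, smul_eq_mul] at this
      simp only [Pi.sub_apply, Pi.smul_apply, Finset.sum_apply, smul_eq_mul, this]
      exact Finset.sum_congr rfl fun j _ => mul_comm _ _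
    rw [h5]
    exact Submodule.sum_mem _ fun j _ => Submodule.smul_mem_smul (y j).2 ((memK _).mpr (ha j))
  set p := g • c - c with hp
  have hpK : p ∈ K := K.sub_mem (hst g c hc) hc
  have hpm : ∀ i, p i ∈ m := fun i => hg (c i)
  have h6 : ∑ i ∈ Finset.range (Nat.card G), g ^ i • p = 0 := by
    have : ∀ i, g ^ i • p = g ^ (i + 1) • c - g ^ i • c := fun i => by
      rw [hp, smul_sub, pow_succ, mul_smul]
    simp only [this]
    rw [Finset.sum_range_sub (fun i => g ^ i • c), pow_card_eq_one', pow_zero, sub_self]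
  have h7 : (Nat.card G : A) • p ∈ m • K := by
    have h8 : (Nat.card G : A) • p = - ∑ i ∈ Finset.range (Nat.card G), (g ^ i • p - p) := by
      rw [Finset.sum_sub_distrib, h6]
      simp [Nat.cast_smul_eq_nsmul]
    rw [h8]
    exact Submodule.neg_mem _ (Submodule.sum_mem _ fun i _ =>
      claim2 (g ^ i) (aux_inertia_pow m g hg i) p hpK hpm)
  exact (Submodule.smul_mem_iff_of_isUnit _ (hA _ Nat.card_pos.ne')).mp h7

end AuxReverse

/-- The reverse direction once generators and relations are generated by invariants. -/
lemma aux_descends (k : Type*) [Field k] [CharZero k]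
    {A : Type u} [CommRing A] [Algebra k A]
    {G : Type*} [Group G] [Finite G] [MulSemiringAction G A] [SMulCommClass G k A]
    {M : Type v} [AddCommGroup M] [Module A M] [DistribMulAction G M]
    (hGM : ∀ (g : G) (a : A) (x : M), g • (a • x) = (g • a) • (g • x))
    {ι : Type*} [Fintype ι] (x : ι → M)
    (hx : ∀ (g : G) i, g • x i = x i) (hspan : Submodule.span A (Set.range x) = ⊤)
    (hrel : LinearMap.ker (Fintype.linearCombination A x) ≤
      Submodule.span A {c : ι → A | c ∈ LinearMap.ker (Fintype.linearCombination A x) ∧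
        ∀ g : G, g • c = c}) :
    Descends k A G M := by
  classical
  have : Fintype G := Fintype.ofFinite G
  have hsurj : ∀ y : M, ∃ c : ι → A, ∑ i, c i • x i = y := by
    intro y
    have hy : y ∈ Submodule.span A (Set.range x) := by rw [hspan]; trivial
    exact (Submodule.mem_span_range_iff_exists_fun A).mp hy
  let Q : Submodule (invAlg k A G) M :=
    { carrier := {y | ∀ g : G, g • y = y}
      zero_mem' := fun g => smul_zero g
      add_mem' := fun ha hb g => by rw [smul_add, ha g, hb g]
      smul_mem' := fun b y hy g => by
        change g • ((b : A) • y) = (b : A) • y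
        rw [hGM, b.2 g, hy g] }
  let X : ι → Q := fun i => ⟨x i, fun g => hx g i⟩
  let e : (A ⊗[invAlg k A G] Q) →ₗ[A] M := LinearMap.liftBaseChange A Q.subtype
  have he : ∀ (a : A) (q : Q), e (a ⊗ₜ q) = a • (q : M) := fun a q => by
    simp [e, LinearMap.liftBaseChange_tmul]
  let Θ : (ι → A) →ₗ[A] (A ⊗[invAlg k A G] Q) :=
    Fintype.linearCombination A (fun i => (1 : A) ⊗ₜ[invAlg k A G] X i)
  have hΘ : ∀ c, Θ c = ∑ i, c i ⊗ₜ[invAlg k A G] X i := fun c => by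
    simp only [Θ, Fintype.linearCombination_apply, TensorProduct.smul_tmul', smul_eq_mul, mul_one]
  have heΘ : ∀ c, e (Θ c) = Fintype.linearCombination A x c := fun c => by
    rw [hΘ, map_sum, Fintype.linearCombination_apply]
    exact Finset.sum_congr rfl fun i _ => he _ _
  have hone : ∀ (b : ι → A) (hb : ∀ i, b i ∈ invAlg k A G) (q : Q),
      ∑ i, b i • x i = q → Θ b = 1 ⊗ₜ q := by
    intro b hb q hq
    have h1 : q = ∑ i, (⟨b i, hb i⟩ : invAlg k A G) • X i := by
      apply Subtype.ext
      rw [← hq, Submodule.coe_sum]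
      rfl
    rw [h1, TensorProduct.tmul_sum, hΘ]
    refine Finset.sum_congr rfl fun i _ => ?_
    rw [← TensorProduct.smul_tmul, Subalgebra.smul_def, smul_eq_mul, mul_one]
  have hcard : (Fintype.card G : k) ≠ 0 := Nat.cast_ne_zero.mpr Fintype.card_ne_zero
  have hΘsurj : Function.Surjective Θ := by
    rw [← LinearMap.range_eq_top, Submodule.eq_top_iff']
    intro z
    induction z with
    | zero => exact Submodule.zero_mem _
    | add s t hs ht => exact Submodule.add_mem _ hs ht
    | tmul a q =>
      obtain ⟨c, hc⟩ := hsurj q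
      let b : ι → A := fun i => (Fintype.card G : k)⁻¹ • ∑ g : G, g • c i
      have hb : ∀ i, b i ∈ invAlg k A G := by
        intro i g
        change g • ((Fintype.card G : k)⁻¹ • ∑ g : G, g • c i) = _
        rw [smul_comm, Finset.smul_sum]
        congr 1
        exact Fintype.sum_equiv (Equiv.mulLeft g) _ _ fun h => by simp [mul_smul]
      have hq : ∑ i, b i • x i = q := by
        have h1 : ∀ g : G, ∑ i, (g • c i) • x i = q := fun g => by
          have h2 := congrArg (g • ·) hc
          simp only [Finset.smul_sum, hGM, hx] at h2
          rw [h2]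
          exact q.2 g
        have h2 : ∀ i, b i • x i = algebraMap k A (Fintype.card G : k)⁻¹ •
            ∑ g : G, (g • c i) • x i := fun i => by
          simp only [b]
          rw [Algebra.smul_def, mul_smul, Finset.sum_smul]
        simp only [h2]
        rw [← Finset.smul_sum, Finset.sum_comm]
        simp only [h1]
        rw [Finset.sum_const, Finset.card_univ, ← Nat.cast_smul_eq_nsmul A, smul_smul,
          ← map_natCast (algebraMap k A), ← map_mul, inv_mul_cancel₀ hcard, map_one, one_smul]
      have h3 := hone b hb q hq
      refine ⟨a • b, ?_⟩
      rw [map_smul, h3, TensorProduct.smul_tmul', smul_eq_mul, mul_one]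
  have hinj : Function.Injective e := by
    rw [injective_iff_map_eq_zero]
    intro z hz
    obtain ⟨c, rfl⟩ := hΘsurj z
    rw [heΘ] at hz
    have hle : Submodule.span A {c : ι → A | c ∈ LinearMap.ker (Fintype.linearCombination A x) ∧
        ∀ g : G, g • c = c} ≤ LinearMap.ker Θ := by
      rw [Submodule.span_le]
      rintro d ⟨hd, hdg⟩
      have h4 := hone d (fun i g => congrFun (hdg g) i) 0 (by
        rw [LinearMap.mem_ker, Fintype.linearCombination_apply] at hd
        exact hd)
      rw [TensorProduct.tmul_zero] at h4
      exact h4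
    exact hle (hrel hz)
  have hesurj : Function.Surjective e := fun y => by
    obtain ⟨c, hc⟩ := hsurj y
    exact ⟨Θ c, by rw [heΘ, Fintype.linearCombination_apply, hc]⟩
  refine ⟨Q, inferInstance, inferInstance, LinearEquiv.ofBijective e ⟨hinj, hesurj⟩, ?_⟩
  intro g a q
  change e _ = g • e _
  rw [he, he, hGM, q.2 g]

/-- **Descent criterion for equivariant coherent sheaves** (affine,
finite-group case).  `M` descends to `Spec Aᴳ` iff for every maximal ideal
`m ⊆ A` the fiber `M ⊗[A] A/m` and `Tor₁ᴬ(M, A/m)` are generated by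
`G_m`-fixed elements. -/
theorem descends_iff_fiber_and_tor_generated_by_stabilizer_invariants
    (k : Type*) [Field k] [CharZero k]
    (A : Type u) [CommRing A] [Algebra k A] [Algebra.FiniteType k A]
    (G : Type*) [Group G] [Finite G] [MulSemiringAction G A] [SMulCommClass G k A]
    (M : Type v) [AddCommGroup M] [Module A M] [Module.Finite A M]
    [DistribMulAction G M]
    (hGM : ∀ (g : G) (a : A) (x : M), g • (a • x) = (g • a) • (g • x)) :
    Descends k A G M ↔
      ∀ m : Ideal A, m.IsMaximal →
        -- `M ⊗[A] A/m` is generated by `G_m`-fixed elements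
        (Submodule.span A {y : M | ∀ g : G, (∀ a : A, g • a ∈ m ↔ a ∈ m) →
            g • y - y ∈ m • (⊤ : Submodule A M)} = ⊤) ∧
        -- `Tor₁ᴬ(M, A/m)` is generated by `G_m`-fixed elements
        (∀ t : m ⊗[A] M, torMul A M m t = 0 →
          t ∈ Submodule.span A {t' : m ⊗[A] M | torMul A M m t' = 0 ∧
            ∀ (g : G) (hg : ∀ a : A, g • a ∈ m ↔ a ∈ m),
              torSmul (MulSemiringAction.toRingHom G A g)
                (DistribMulAction.toAddMonoidHom M g)
                (fun a x => hGM g a x) m (fun a ha => (hg a).mpr ha) t' = t'}) := by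
  have hA : ∀ n : ℕ, n ≠ 0 → IsUnit (n : A) := fun n hn => by
    rw [← map_natCast (algebraMap k A)]
    exact (IsUnit.mk0 (n : k) (Nat.cast_ne_zero.mpr hn)).map _
  constructor
  · rintro ⟨Q, _, _, e, he⟩ m hm
    refine ⟨?_, ?_⟩
    · rw [Submodule.eq_top_iff']
      intro y
      obtain ⟨z, rfl⟩ := e.surjective y
      induction z with
      | zero => rw [map_zero]; exact Submodule.zero_mem _
      | add s t hs ht => rw [map_add]; exact Submodule.add_mem _ hs ht
      | tmul a q =>
        have hb : (a ⊗ₜ[invAlg k A G] q : A ⊗[invAlg k A G] Q) = a • (1 ⊗ₜ q) := by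
          rw [TensorProduct.smul_tmul', smul_eq_mul, mul_one]
        rw [hb, map_smul]
        refine Submodule.smul_mem _ _ (Submodule.subset_span fun g _ => ?_)
        rw [← he, smul_one, sub_self]
        exact Submodule.zero_mem _
    · intro t ht
      exact aux_tor_generated hGM m hm
        (fun n hn hmem => hm.ne_top (Ideal.eq_top_of_isUnit_mem _ hmem (hA n hn)))
        (fun g hg t ht => aux_forward_inertia k hGM e he m g hg t ht) t ht
  · intro h
    have : IsNoetherianRing A := Algebra.FiniteType.isNoetherianRing k A
    have h1 := aux_generated hGM hA (⊤ : Submodule A M) Module.Finite.fg_top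
      (fun _ _ _ => trivial) (by
        intro m hm g hg y _
        have hy : y ∈ Submodule.span A {y : M | ∀ g : G, (∀ a : A, g • a ∈ m ↔ a ∈ m) →
            g • y - y ∈ m • (⊤ : Submodule A M)} := by rw [(h m hm).1]; trivial
        induction hy using Submodule.span_induction with
        | mem y hy => exact hy g (aux_inertia_stab m g hg)
        | zero => simp
        | add s t _ _ hs ht =>
          have := Submodule.add_mem _ (hs trivial) (ht trivial)
          rw [smul_add, add_sub_add_comm]
          exact this
        | smul a t _ ht =>
          have e1 : g • a • t - a • t = (g • a) • (g • t - t) + (g • a - a) • t := by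
            rw [hGM, smul_sub, sub_smul]; abel
          rw [e1]
          exact Submodule.add_mem _ (Submodule.smul_mem _ _ (ht trivial))
            (Submodule.smul_mem_smul (hg a) trivial))
    have h2 := top_le_iff.mp h1
    have hfg : (Submodule.span A {x : M | x ∈ (⊤ : Submodule A M) ∧ ∀ g : G, g • x = x}).FG := by
      rw [h2]; exact Module.Finite.fg_top
    obtain ⟨s, hs, hs'⟩ := (Submodule.fg_span_iff_fg_span_finset_subset _).mp hfg
    have hx : ∀ (g : G) (i : s), g • (i : M) = i := fun g i => (hs i.2).2 g
    have hspan : Submodule.span A (Set.range (fun i : s => (i : M))) = ⊤ := by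
      rw [← h2, hs']
      congr 1
      ext y
      simp
    refine aux_descends k hGM (fun i : s => (i : M)) hx hspan ?_
    refine aux_generated (fun g a c => ?_) hA _ (IsNoetherian.noetherian _) ?_ ?_
    · ext i
      simp [smul_mul']
    · intro g c hc
      rw [LinearMap.mem_ker, Fintype.linearCombination_apply] at hc ⊢
      have := congrArg (g • ·) hc
      simp only [Finset.smul_sum, hGM, hx, smul_zero] at this
      exact this
    · intro m hm g hg c hc
      exact aux_relations hGM hA _ hx hspan m (h m hm).2 g hg c hc
end

section
/- Let k be an algebraically closed field of characteristic zero, A a finitely generated commutative k-algebra, G a finite group acting on A by k-algebra automorphisms, and P a finitely generated projective A-module carrying a G-equivariant structure. Then P descends to Spec A^G if and only if for every maximal ideal m of A the stabilizer G_m acts trivially on the fiber P ⊗_A A/m. -/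
/-!
STATEMENT 2 (Kempf's descent criterion for vector bundles, affine
finite-group case): for an algebraically closed field `k` of characteristic
zero, a finitely generated commutative `k`-algebra `A`, a finite group `G`
acting on `A` by `k`-algebra automorphisms, and a finitely generated
projective `A`-module `P` with a `G`-equivariant structure, `P` descends to
`Spec Aᴳ` if and only if for every maximal ideal `m` of `A` the stabilizer
`G_m` acts trivially on the fiber `P ⊗[A] A/m`.

The fiber `P ⊗[A] A/m` is realized as `P/mP`; "`g` fixes the class of `y`"
becomes `g • y - y ∈ m • ⊤`.
-/

open TensorProduct

universe u v

lemma kempf_nakayama {A : Type*} [CommRing A] {P : Type*} [AddCommGroup P] [Module A P]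
    [Module.Finite A P] (L : Submodule A P)
    (h : ∀ m : Ideal A, m.IsMaximal → ∀ y : P, y ∈ L ⊔ m • (⊤ : Submodule A P)) : L = ⊤ := by
  by_contra hL
  have hI : Module.annihilator A (P ⧸ L) ≠ ⊤ := by
    intro hI
    apply hL
    rw [eq_top_iff]
    intro y _
    have h1 : (1 : A) ∈ Module.annihilator A (P ⧸ L) := by rw [hI]; trivial
    have := Module.mem_annihilator.1 h1 (L.mkQ y)
    rw [one_smul] at this
    simpa using this
  obtain ⟨m, hm, hIm⟩ := Ideal.exists_le_maximal _ hI
  obtain ⟨r, hr, hr0⟩ := Submodule.exists_sub_one_mem_and_smul_eq_zero_of_fg_of_le_smul m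
    (⊤ : Submodule A (P ⧸ L)) Module.Finite.fg_top (by
      have h2 : L ⊔ m • (⊤ : Submodule A P) = ⊤ := by
        rw [eq_top_iff]; intro y _; exact h m hm y
      have h3 := congrArg (Submodule.map L.mkQ) h2
      rw [Submodule.map_sup, Submodule.map_smul'', Submodule.map_top, Submodule.range_mkQ] at h3
      have h4 : Submodule.map L.mkQ L = ⊥ := by
        rw [← le_bot_iff, Submodule.map_le_iff_le_comap, Submodule.comap_bot, Submodule.ker_mkQ]
      rw [h4, bot_sup_eq] at h3
      exact h3.ge)
  have hrm : r ∈ m := hIm (Module.mem_annihilator.2 fun x => hr0 x trivial)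
  exact hm.ne_top ((Ideal.eq_top_iff_one m).2 (by simpa using m.sub_mem hrm hr))

lemma kempf_bump {A : Type*} [CommRing A] {G : Type*} [Group G] [Finite G]
    [MulSemiringAction G A] (m : Ideal A) (hm : m.IsMaximal) :
    ∃ b : A, b - 1 ∈ m ∧ ∀ g : G, (¬ ∀ a : A, g • a ∈ m ↔ a ∈ m) → g • b ∈ m := by
  classical
  cases nonempty_fintype G
  have key : ∀ g : G, ∃ c : A, c - 1 ∈ m ∧ ((¬ ∀ a : A, g • a ∈ m ↔ a ∈ m) → g • c ∈ m) := by
    intro g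
    by_cases hg : ∀ a : A, g • a ∈ m ↔ a ∈ m
    · exact ⟨1, by simp, fun h => absurd hg h⟩
    · have hm' : (m.comap (MulSemiringAction.toRingEquiv G A g)).IsMaximal :=
        Ideal.comap_isMaximal_of_equiv _
      have hne : m ≠ m.comap (MulSemiringAction.toRingEquiv G A g) := by
        intro h
        apply hg
        intro a
        conv_rhs => rw [h]
        rfl
      have hs := Ideal.IsMaximal.coprime_of_ne hm hm' hne
      obtain ⟨u, hu, v, hv, huv⟩ := Submodule.mem_sup.1 ((Ideal.eq_top_iff_one _).1 hs)
      refine ⟨v, ?_, fun _ => hv⟩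
      rw [← huv]
      simpa using hu
  choose c hc1 hc2 using key
  refine ⟨∏ g, c g, ?_, fun g hg => ?_⟩
  · rw [← Ideal.Quotient.eq, map_prod, map_one]
    refine Finset.prod_eq_one fun g _ => ?_
    rw [← map_one (Ideal.Quotient.mk m), Ideal.Quotient.eq]
    exact hc1 g
  · rw [← Finset.mul_prod_erase _ _ (Finset.mem_univ g), smul_mul']
    exact m.mul_mem_right _ (hc2 g hg)

lemma kempf_span {k : Type*} [Field k] [CharZero k]
    {A : Type*} [CommRing A] [Algebra k A]
    {G : Type*} [Group G] [Finite G] [MulSemiringAction G A]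
    {P : Type*} [AddCommGroup P] [Module A P] [Module.Finite A P] [DistribMulAction G P]
    (hGP : ∀ (g : G) (a : A) (x : P), g • (a • x) = (g • a) • (g • x))
    (H : ∀ m : Ideal A, m.IsMaximal →
        ∀ (y : P) (g : G), (∀ a : A, g • a ∈ m ↔ a ∈ m) →
          g • y - y ∈ m • (⊤ : Submodule A P)) :
    Submodule.span A {x : P | ∀ g : G, g • x = x} = ⊤ := by
  classical
  cases nonempty_fintype G
  refine kempf_nakayama _ fun m hm y => ?_
  obtain ⟨b, hb1, hb⟩ := kempf_bump (G := G) m hm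
  set S : Finset G := Finset.univ.filter fun g => ∀ a : A, g • a ∈ m ↔ a ∈ m with hS
  have hz : (∑ g : G, g • (b • y)) ∈ Submodule.span A {x : P | ∀ g : G, g • x = x} := by
    apply Submodule.subset_span
    intro h
    rw [Finset.smul_sum]
    simp_rw [smul_smul]
    exact Fintype.sum_equiv (Equiv.mulLeft h) _ _ fun g => by simp [mul_smul]
  have hd : (∑ g : G, g • (b • y)) - ((S.card : ℕ) : A) • y ∈ m • (⊤ : Submodule A P) := by
    have : ((S.card : ℕ) : A) • y = ∑ g : G, if (∀ a : A, g • a ∈ m ↔ a ∈ m) then y else 0 := by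
      rw [← Finset.sum_filter, Finset.sum_const, Nat.cast_smul_eq_nsmul]
    rw [this, ← Finset.sum_sub_distrib]
    refine Submodule.sum_mem _ fun g _ => ?_
    rw [hGP]
    split_ifs with hg
    · have h1 : g • b - 1 ∈ m := by
        have := (hg (b - 1)).2 hb1
        rwa [smul_sub, smul_one] at this
      have h2 := H m hm y g hg
      have : (g • b) • (g • y) - y = (g • b - 1) • (g • y) + (g • y - y) := by
        rw [sub_smul, one_smul]; abel
      rw [this]
      exact Submodule.add_mem _ (Submodule.smul_mem_smul h1 trivial) h2
    · rw [sub_zero]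
      exact Submodule.smul_mem_smul (hb g hg) trivial
  have hN : S.card ≠ 0 := by
    apply Finset.card_ne_zero_of_mem (a := (1 : G))
    simp [hS]
  have hNk : ((S.card : ℕ) : k) ≠ 0 := by exact_mod_cast hN
  have hu : algebraMap k A ((S.card : k)⁻¹) * ((S.card : ℕ) : A) = 1 := by
    rw [← map_natCast (algebraMap k A), ← map_mul, inv_mul_cancel₀ hNk, map_one]
  have hNy : ((S.card : ℕ) : A) • y ∈
      Submodule.span A {x : P | ∀ g : G, g • x = x} ⊔ m • (⊤ : Submodule A P) := by
    have := Submodule.sub_mem _ (Submodule.mem_sup_left (T := m • (⊤ : Submodule A P)) hz)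
      (Submodule.mem_sup_right hd)
    simpa using this
  have := Submodule.smul_mem _ (algebraMap k A ((S.card : k)⁻¹)) hNy
  rwa [smul_smul, hu, one_smul] at this

/-- An equivariant dual basis consisting of invariant elements. -/
lemma kempf_dual {k : Type*} [Field k] [CharZero k]
    {A : Type*} [CommRing A] [Algebra k A]
    {G : Type*} [Group G] [Finite G] [MulSemiringAction G A] [SMulCommClass G k A]
    {P : Type*} [AddCommGroup P] [Module A P] [Module.Finite A P] [Module.Projective A P]
    [DistribMulAction G P]
    (hGP : ∀ (g : G) (a : A) (x : P), g • (a • x) = (g • a) • (g • x))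
    (hspan : Submodule.span A {x : P | ∀ g : G, g • x = x} = ⊤) :
    ∃ (t : Finset P) (f : P → (P →ₗ[A] A)), (∀ q ∈ t, ∀ g : G, g • q = q) ∧
      (∀ q (g : G) y, f q (g • y) = g • f q y) ∧ ∀ y, ∑ q ∈ t, f q y • q = y := by
  classical
  cases nonempty_fintype G
  have hfg : (Submodule.span A {x : P | ∀ g : G, g • x = x}).FG := by
    rw [hspan]; exact Module.Finite.fg_top
  obtain ⟨t, ht, hst⟩ := (Submodule.fg_span_iff_fg_span_finset_subset _).1 hfg
  rw [hspan] at hst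
  have hsurj : Function.Surjective (Fintype.linearCombination A (fun q : t => (q : P))) := by
    rw [← LinearMap.range_eq_top, Fintype.range_linearCombination]
    simpa using hst.symm
  obtain ⟨s, hs⟩ := Module.projective_lifting_property
    (Fintype.linearCombination A (fun q : t => (q : P))) LinearMap.id hsurj
  let f0 : P → (P →ₗ[A] A) := fun q => if h : q ∈ t then LinearMap.proj ⟨q, h⟩ ∘ₗ s else 0
  have hf0 : ∀ y, ∑ q ∈ t, f0 q y • q = y := by
    intro y
    have := LinearMap.congr_fun hs y
    rw [LinearMap.comp_apply, Fintype.linearCombination_apply, LinearMap.id_apply] at this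
    conv_rhs => rw [← this]
    rw [← Finset.sum_coe_sort]
    refine Finset.sum_congr rfl fun q _ => ?_
    simp [f0]
  have hNk : ((Fintype.card G : ℕ) : k) ≠ 0 := by exact_mod_cast Fintype.card_ne_zero
  set c : A := algebraMap k A ((Fintype.card G : k)⁻¹) with hc
  have hcN : c * ((Fintype.card G : ℕ) : A) = 1 := by
    rw [hc, ← map_natCast (algebraMap k A), ← map_mul, inv_mul_cancel₀ hNk, map_one]
  have hcg : ∀ g : G, g • c = c := by
    intro g
    rw [hc, Algebra.algebraMap_eq_smul_one, smul_comm, smul_one]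
  let f : P → (P →ₗ[A] A) := fun q =>
    { toFun := fun y => c * ∑ g : G, g • f0 q (g⁻¹ • y)
      map_add' := fun x y => by simp [smul_add, Finset.sum_add_distrib, mul_add]
      map_smul' := fun a y => by
        simp only [hGP, map_smul, smul_eq_mul, smul_mul', smul_inv_smul, RingHom.id_apply]
        rw [← Finset.mul_sum]; ring }
  have hf : ∀ q y, f q y = c * ∑ g : G, g • f0 q (g⁻¹ • y) := fun _ _ => rfl
  refine ⟨t, f, fun q hq => ht hq, ?_, ?_⟩
  · intro q h y
    rw [hf, hf, smul_mul', hcg, Finset.smul_sum]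
    congr 1
    refine Fintype.sum_equiv (Equiv.mulLeft h⁻¹) _ _ fun g => ?_
    simp [smul_smul]
  · intro y
    have : ∀ q ∈ t, f q y • q = c • ∑ g : G, g • (f0 q (g⁻¹ • y) • q) := by
      intro q hq
      rw [hf, mul_smul, Finset.sum_smul]
      congr 1
      refine Finset.sum_congr rfl fun g _ => ?_
      rw [hGP, ht hq g]
    rw [Finset.sum_congr rfl this, ← Finset.smul_sum, Finset.sum_comm]
    simp_rw [← Finset.smul_sum, hf0, smul_inv_smul]
    rw [Finset.sum_const, Finset.card_univ, ← Nat.cast_smul_eq_nsmul A, smul_smul, hcN, one_smul]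

/-- The module of invariants. -/
def kempfInv (k : Type*) (A : Type*) (G : Type*) [Field k] [CommRing A]
    [Algebra k A] [Group G] [MulSemiringAction G A] [SMulCommClass G k A]
    (P : Type*) [AddCommGroup P] [Module A P] [DistribMulAction G P]
    (hGP : ∀ (g : G) (a : A) (x : P), g • (a • x) = (g • a) • (g • x)) :
    Submodule (invAlg k A G) P where
  carrier := {x | ∀ g : G, g • x = x}
  zero_mem' := fun g => smul_zero g
  add_mem' := fun ha hb g => by rw [smul_add, ha g, hb g]
  smul_mem' := fun c x hx g => by
    have := hGP g (c : A) x
    rw [c.2 g, hx g] at this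
    exact this

lemma kempf_scalar {k : Type*} [Field k] [IsAlgClosed k]
    {A : Type*} [CommRing A] [Algebra k A] [Algebra.FiniteType k A]
    (m : Ideal A) (hm : m.IsMaximal) (a : A) : ∃ c : k, a - algebraMap k A c ∈ m := by
  let _ := Ideal.Quotient.field m
  have : Algebra.FiniteType k (A ⧸ m) :=
    Algebra.FiniteType.of_surjective (Ideal.Quotient.mkₐ k m) Ideal.Quotient.mk_surjective
  have : Module.Finite k (A ⧸ m) := finite_of_finite_type_of_isJacobsonRing k (A ⧸ m)
  obtain ⟨c, hc⟩ := (IsAlgClosed.algebraMap_bijective_of_isIntegral (k := k) (K := A ⧸ m)).2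
    (Ideal.Quotient.mk m a)
  refine ⟨c, ?_⟩
  rw [← Ideal.Quotient.eq, ← hc]
  rfl

/-- **Kempf's descent criterion** (affine finite-group case): a finitely
generated projective `G`-equivariant `A`-module `P` descends to `Spec Aᴳ` iff
for every maximal ideal `m ⊆ A` the stabilizer `G_m` acts trivially on the
fiber `P ⊗[A] A/m`. -/
theorem projective_descends_iff_stabilizers_act_trivially_on_fibers
    (k : Type*) [Field k] [CharZero k] [IsAlgClosed k]
    (A : Type u) [CommRing A] [Algebra k A] [Algebra.FiniteType k A]
    (G : Type*) [Group G] [Finite G] [MulSemiringAction G A] [SMulCommClass G k A]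
    (P : Type v) [AddCommGroup P] [Module A P] [Module.Finite A P]
    [Module.Projective A P] [DistribMulAction G P]
    (hGP : ∀ (g : G) (a : A) (x : P), g • (a • x) = (g • a) • (g • x)) :
    Descends k A G P ↔
      ∀ m : Ideal A, m.IsMaximal →
        ∀ (y : P) (g : G), (∀ a : A, g • a ∈ m ↔ a ∈ m) →
          g • y - y ∈ m • (⊤ : Submodule A P) := by
  constructor
  · rintro ⟨Q, _, _, e, he⟩ m hm y g hg
    obtain ⟨x, rfl⟩ := e.surjective y
    induction x with
    | zero => simp
    | add x y hx hy =>
      have : g • e (x + y) - e (x + y) = (g • e x - e x) + (g • e y - e y) := by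
        rw [map_add, smul_add]; abel
      rw [this]
      exact Submodule.add_mem _ hx hy
    | tmul a q =>
      rw [← he, ← map_sub, ← TensorProduct.sub_tmul]
      have h1 : (g • a - a) ⊗ₜ[invAlg k A G] q = (g • a - a) • ((1 : A) ⊗ₜ[invAlg k A G] q) := by
        rw [TensorProduct.smul_tmul', smul_eq_mul, mul_one]
      rw [h1, map_smul]
      refine Submodule.smul_mem_smul ?_ trivial
      obtain ⟨c, hc⟩ := kempf_scalar (k := k) m hm a
      have h2 := m.sub_mem ((hg _).2 hc) hc
      have h3 : g • algebraMap k A c = algebraMap k A c := by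
        rw [Algebra.algebraMap_eq_smul_one, smul_comm, smul_one]
      rw [smul_sub, h3] at h2
      simpa using h2
  · intro H
    classical
    obtain ⟨t, f, ht, hf, hsum⟩ := kempf_dual (k := k) hGP (kempf_span (k := k) hGP H)
    let Q := kempfInv k A G P hGP
    let φ : A ⊗[invAlg k A G] Q →ₗ[A] P := LinearMap.liftBaseChange A Q.subtype
    have hφ : ∀ (a : A) (q : Q), φ (a ⊗ₜ q) = a • (q : P) := fun a q => by simp [φ]
    let ψ : P →ₗ[A] A ⊗[invAlg k A G] Q :=
      ∑ q : t, (LinearMap.toSpanSingleton A (A ⊗[invAlg k A G] Q)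
        ((1 : A) ⊗ₜ (⟨q.1, ht q.1 q.2⟩ : Q))) ∘ₗ f q.1
    have hψ : ∀ y, ψ y = ∑ q : t, (f q.1 y) ⊗ₜ[invAlg k A G] (⟨q.1, ht q.1 q.2⟩ : Q) := by
      intro y
      simp [ψ, LinearMap.sum_apply, TensorProduct.smul_tmul']
    have h1 : φ ∘ₗ ψ = LinearMap.id := by
      ext y
      rw [LinearMap.comp_apply, hψ, map_sum, LinearMap.id_apply]
      simp only [hφ]
      rw [Finset.sum_coe_sort t (fun q => f q y • q)]
      exact hsum y
    have h2' : ∀ q : Q, ψ (q : P) = (1 : A) ⊗ₜ q := by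
      intro q
      rw [hψ]
      have hinv : ∀ p : P, ∀ g : G, g • f p (q : P) = f p (q : P) := by
        intro p g
        rw [← hf, q.2 g]
      have h3 : ∀ p : t, (f p.1 (q : P)) ⊗ₜ[invAlg k A G] (⟨p.1, ht p.1 p.2⟩ : Q) =
          (1 : A) ⊗ₜ[invAlg k A G]
            ((⟨f p.1 (q : P), hinv p.1⟩ : invAlg k A G) • (⟨p.1, ht p.1 p.2⟩ : Q)) := by
        intro p
        rw [← TensorProduct.smul_tmul]
        congr 1
        rw [Subalgebra.smul_def, smul_eq_mul, mul_one]
      rw [Finset.sum_congr rfl fun p _ => h3 p, ← TensorProduct.tmul_sum]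
      congr 1
      apply Subtype.ext
      rw [AddSubmonoidClass.coe_finset_sum]
      refine Eq.trans ?_ (hsum (q : P))
      rw [← Finset.sum_coe_sort t (fun p => f p (q : P) • p)]
      rfl
    have h2 : ψ ∘ₗ φ = LinearMap.id := by
      apply LinearMap.ext
      intro x
      induction x with
      | zero => simp
      | add x y hx hy => rw [map_add, hx, hy, map_add]
      | tmul a q =>
        rw [LinearMap.comp_apply, hφ, map_smul, h2', TensorProduct.smul_tmul', smul_eq_mul,
          mul_one, LinearMap.id_apply]
    refine ⟨Q, inferInstance, inferInstance, LinearEquiv.ofLinear φ ψ h1 h2, fun g a q => ?_⟩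
    rw [LinearEquiv.ofLinear_apply, LinearEquiv.ofLinear_apply, hφ, hφ, hGP, q.2 g]
end

section
/- Let k be a field of characteristic zero, A a finitely generated commutative k-algebra, G a finite group acting on A by k-algebra automorphisms, and E a bounded-above cochain complex of finitely generated projective A-modules, each term carrying a G-equivariant structure and all differentials G-equivariant. Then the following are equivalent: (1) there exist a bounded-above cochain complex Q of projective A^G-modules and a G-equivariant quasi-isomorphism A ⊗_{A^G} Q → E (G acting through the factor A); (2) for every maximal ideal n of A and every integer j, the A/n-module H^j(E ⊗_A A/n) is generated by elements fixed by the stabilizer G_n. -/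
open TensorProduct

universe u v w

/-- A (`ℤ`-indexed, cohomologically graded) cochain complex of `R`-modules,
with differentials indexed by pairs `(i, j)` with `i + 1 = j`. -/
structure ModComplex.{s, r} (R : Type s) [Ring R] : Type (max s (r + 1)) where
  X : ℤ → Type r
  [acg : ∀ j, AddCommGroup (X j)]
  [mod : ∀ j, Module R (X j)]
  d : ∀ i j : ℤ, i + 1 = j → (X i →ₗ[R] X j)
  d_comp_d : ∀ (i j l : ℤ) (hij : i + 1 = j) (hjl : j + 1 = l) (x : X i),
    d j l hjl (d i j hij x) = 0

attribute [instance] ModComplex.acg ModComplex.mod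

/-- A `G`-equivariant cochain complex of `A`-modules: each term carries a
`G`-action compatible with the `G`-action on `A`, and the differentials are
`G`-equivariant. -/
structure EqvModComplex.{s, t, r} (A : Type s) (G : Type t) [CommRing A]
    [Group G] [MulSemiringAction G A] : Type (max s t (r + 1)) where
  X : ℤ → Type r
  [acg : ∀ j, AddCommGroup (X j)]
  [mod : ∀ j, Module A (X j)]
  [act : ∀ j, DistribMulAction G (X j)]
  equivariant : ∀ (j : ℤ) (g : G) (a : A) (x : X j),
    g • (a • x) = (g • a) • (g • x)
  d : ∀ i j : ℤ, i + 1 = j → (X i →ₗ[A] X j)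
  d_comp_d : ∀ (i j l : ℤ) (hij : i + 1 = j) (hjl : j + 1 = l) (x : X i),
    d j l hjl (d i j hij x) = 0
  d_equivariant : ∀ (i j : ℤ) (h : i + 1 = j) (g : G) (x : X i),
    d i j h (g • x) = g • d i j h x

attribute [instance] EqvModComplex.acg EqvModComplex.mod EqvModComplex.act


/-- `g` stabilizes the ideal `n`. -/
def StabIdeal {A G : Type*} [CommRing A] [Group G] [MulSemiringAction G A] (n : Ideal A) (g : G) : Prop :=
  ∀ a : A, g • a ∈ n ↔ a ∈ n

theorem StabIdeal.mul {A G : Type*} [CommRing A] [Group G] [MulSemiringAction G A] {n : Ideal A} {g h : G}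
    (hg : StabIdeal n g) (hh : StabIdeal n h) : StabIdeal n (g * h) := fun a => by
  rw [mul_smul, hg, hh]

theorem StabIdeal.inv {A G : Type*} [CommRing A] [Group G] [MulSemiringAction G A] {n : Ideal A} {g : G}
    (hg : StabIdeal n g) : StabIdeal n g⁻¹ := fun a => by
  rw [← hg, smul_inv_smul]

theorem StabIdeal.one {A G : Type*} [CommRing A] [Group G] [MulSemiringAction G A] {n : Ideal A} :
    StabIdeal n (1 : G) := fun a => by
  rw [one_smul]

theorem smul_mem_smul_top {A G T : Type*} [CommRing A] [Group G] [MulSemiringAction G A]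
    [AddCommGroup T] [Module A T] [DistribMulAction G T]
    (heq : ∀ (g : G) (a : A) (x : T), g • (a • x) = (g • a) • (g • x))
    {n : Ideal A} {g : G} (hg : StabIdeal n g) {t : T} (ht : t ∈ n • (⊤ : Submodule A T)) :
    g • t ∈ n • (⊤ : Submodule A T) := by
  induction ht using Submodule.smul_induction_on' with
  | smul r hr x hx =>
    rw [heq]
    exact Submodule.smul_mem_smul ((hg r).2 hr) trivial
  | add x hx y hy h1 h2 => rw [smul_add]; exact add_mem h1 h2

theorem map_mem_smul_top {A T T' : Type*} [CommRing A]
    [AddCommGroup T] [Module A T] [AddCommGroup T'] [Module A T'] (f : T →ₗ[A] T')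
    {n : Ideal A} {t : T} (ht : t ∈ n • (⊤ : Submodule A T)) :
    f t ∈ n • (⊤ : Submodule A T') := by
  have : f t ∈ (n • (⊤ : Submodule A T)).map f := Submodule.mem_map_of_mem ht
  rw [Submodule.map_smul''] at this
  exact Submodule.smul_mono le_rfl le_top this

theorem sum_smul_invariant {A G T : Type*} [CommRing A] [Group G] [Fintype G] [MulSemiringAction G A]
    [AddCommGroup T] [DistribMulAction G T] (n : Ideal A) [DecidablePred (StabIdeal (G := G) n)] (h : G)
    (hh : StabIdeal n h) (t : T) :
    h • ∑ g ∈ Finset.univ.filter (StabIdeal (G := G) n), g • t =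
      ∑ g ∈ Finset.univ.filter (StabIdeal (G := G) n), g • t := by
  rw [Finset.smul_sum]
  refine Finset.sum_equiv (Equiv.mulLeft h) ?_ ?_
  · intro i
    simp only [Finset.mem_filter, Finset.mem_univ, true_and, Equiv.coe_mulLeft]
    refine ⟨fun hi => hh.mul hi, fun hi => ?_⟩
    have := hh.inv.mul hi
    rwa [inv_mul_cancel_left] at this
  · intro i hi
    simp [mul_smul]

theorem lemT {A G T : Type*} [CommRing A] [Group G] [Finite G] [MulSemiringAction G A]
    [AddCommGroup T] [Module A T] [DistribMulAction G T]
    (hN : ∀ m : ℕ, m ≠ 0 → IsUnit (m : A))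
    (heq : ∀ (g : G) (a : A) (x : T), g • (a • x) = (g • a) • (g • x))
    (n : Ideal A) (hn : n.IsMaximal)
    (hI : ∀ g : G, (∀ a : A, g • a - a ∈ n) → ∀ t : T, g • t - t ∈ n • (⊤ : Submodule A T))
    (K : Submodule A T) (hnK : n • ⊤ ≤ K)
    (hK : ∀ g : G, StabIdeal n g → ∀ t ∈ K, g • t ∈ K) :
    K ≤ Submodule.span A {t : T | t ∈ K ∧ ∀ g : G, StabIdeal n g → g • t - t ∈ n • (⊤ : Submodule A T)} := by
  classical
  cases nonempty_fintype G
  set S := Submodule.span A {t : T | t ∈ K ∧ ∀ g : G, StabIdeal n g → g • t - t ∈ n • (⊤ : Submodule A T)} with hS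
  have hnS : n • (⊤ : Submodule A T) ≤ S := fun t ht => Submodule.subset_span
    ⟨hnK ht, fun g hg => sub_mem (smul_mem_smul_top heq hg ht) ht⟩
  have hex : ∀ σ : G, ∃ c b : A, (¬ ∀ a : A, σ • a - a ∈ n) → b * (c - σ • c) - 1 ∈ n := by
    intro σ
    by_cases h : ∀ a : A, σ • a - a ∈ n
    · exact ⟨0, 0, fun h' => absurd h h'⟩
    · push Not at h
      obtain ⟨c, hc⟩ := h
      have hc' : c - σ • c ∉ n := fun h => hc (by rw [← neg_sub]; exact n.neg_mem h)
      obtain ⟨b, i, hi, hb⟩ := hn.exists_inv hc'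
      refine ⟨c, b, fun _ => ?_⟩
      rw [← hb]; ring_nf; exact n.neg_mem hi
  choose c b hcb using hex
  set Γ := Finset.univ.filter (StabIdeal (G := G) n)
  have main : ∀ s : Finset G, ∀ t ∈ K,
      ∑ g ∈ Γ, (∏ σ ∈ s, b σ * (g • c σ - σ • c σ)) • g • t ∈ S := by
    intro s
    induction s using Finset.induction_on with
    | empty =>
      intro t ht
      simp only [Finset.prod_empty, one_smul]
      refine Submodule.subset_span ⟨sum_mem fun g hg => hK g (Finset.mem_filter.1 hg).2 t ht, fun g hg => ?_⟩
      rw [sum_smul_invariant n g hg, sub_self]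
      exact zero_mem _
    | insert σ s hσ ih =>
      intro t ht
      have h1 := S.smul_mem (b σ) (ih (c σ • t) (K.smul_mem _ ht))
      have h2 := S.smul_mem (b σ * σ • c σ) (ih t ht)
      have h3 := sub_mem h1 h2
      convert h3 using 1
      rw [Finset.smul_sum, Finset.smul_sum, ← Finset.sum_sub_distrib]
      refine Finset.sum_congr rfl fun g hg => ?_
      rw [Finset.prod_insert hσ, heq, smul_smul, smul_smul, smul_smul, ← sub_smul]
      congr 1; ring
  intro t ht
  have h1 := main (Γ.filter fun σ => ¬ ∀ a : A, σ • a - a ∈ n) t ht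
  set J := Γ.filter fun σ => ∀ a : A, σ • a - a ∈ n with hJ
  have h2 : ∑ g ∈ Γ, (∏ σ ∈ Γ.filter fun σ => ¬ ∀ a : A, σ • a - a ∈ n, b σ * (g • c σ - σ • c σ)) • g • t
      - ∑ g ∈ Γ, (if ∀ a : A, g • a - a ∈ n then t else 0) ∈ S := by
    rw [← Finset.sum_sub_distrib]
    refine sum_mem fun g hg => ?_
    split_ifs with hgI
    · apply hnS
      have e : (∏ σ ∈ Γ.filter fun σ => ¬ ∀ a : A, σ • a - a ∈ n, b σ * (g • c σ - σ • c σ)) - 1 ∈ n := by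
        rw [← Ideal.Quotient.eq, map_prod, map_one]
        refine Finset.prod_eq_one fun σ hσ => ?_
        rw [← map_one (Ideal.Quotient.mk n), Ideal.Quotient.eq]
        have e1 := hcb σ (Finset.mem_filter.1 hσ).2
        have e2 := n.mul_mem_left (b σ) (hgI (c σ))
        have e3 := add_mem e1 e2
        convert e3 using 1; ring
      have e4 := add_mem (Submodule.smul_mem_smul e (Submodule.mem_top : g • t ∈ (⊤ : Submodule A T))) (hI g hgI t)
      rw [sub_smul, one_smul] at e4
      simpa using e4
    · rw [Finset.prod_eq_zero (i := g)]
      · simp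
      · exact Finset.mem_filter.2 ⟨hg, hgI⟩
      · simp
  have h3 := sub_mem h1 h2
  rw [sub_sub_cancel, ← Finset.sum_filter, Finset.sum_const, ← Nat.cast_smul_eq_nsmul A] at h3
  obtain ⟨u, hu⟩ := hN J.card (by
    rw [Finset.card_ne_zero]
    refine ⟨1, ?_⟩
    simp [hJ, Γ, StabIdeal.one])
  rw [← hu] at h3
  exact (S.smul_mem_iff_of_isUnit u.isUnit).1 h3


theorem contraction_step {A X0 X1 X2 : Type*} [CommRing A]
    [AddCommGroup X0] [Module A X0] [AddCommGroup X1] [Module A X1] [AddCommGroup X2] [Module A X2]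
    [Module.Projective A X1] (d0 : X0 →ₗ[A] X1) (d1 : X1 →ₗ[A] X2)
    (s : X2 →ₗ[A] X1) (hs : ∀ x, d1 (s (d1 x)) = d1 x)
    (hex : ∀ x, d1 x = 0 → ∃ y, d0 y = x) :
    ∃ s' : X1 →ₗ[A] X0, ∀ x, d1 x = 0 → d0 (s' x) = x := by
  let π : X1 →ₗ[A] X1 := LinearMap.id - s ∘ₗ d1
  have hπ : ∀ x, π x ∈ LinearMap.range d0 := fun x => by
    obtain ⟨y, hy⟩ := hex (π x) (by simp [π, hs])
    exact ⟨y, hy⟩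
  obtain ⟨s', hs'⟩ := Module.projective_lifting_property d0.rangeRestrict (π.codRestrict _ hπ)
    d0.surjective_rangeRestrict
  refine ⟨s', fun x hx => ?_⟩
  have := congrArg Subtype.val (LinearMap.congr_fun hs' x)
  simpa [π, hx] using this

theorem le_of_forall_maximal {A X : Type*} [CommRing A] [AddCommGroup X] [Module A X]
    (Z B : Submodule A X) (hZ : Z.FG)
    (h : ∀ n : Ideal A, n.IsMaximal → Z ≤ B ⊔ n • Z) : Z ≤ B := by
  set N := Z.map B.mkQ with hNdef
  have hN : N.FG := hZ.map _
  have hle : ∀ n : Ideal A, n.IsMaximal → N ≤ n • N := by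
    intro n hn
    rw [hNdef, ← Submodule.map_smul'']
    refine (Submodule.map_mono (h n hn)).trans ?_
    rw [Submodule.map_sup]
    simp
  have hann : N.annihilator = ⊤ := by
    by_contra hne
    obtain ⟨n, hn, hle'⟩ := Ideal.exists_le_maximal _ hne
    obtain ⟨r, hr, hr'⟩ := Submodule.exists_sub_one_mem_and_smul_eq_zero_of_fg_of_le_smul n N hN (hle n hn)
    have : r ∈ n := hle' (Submodule.mem_annihilator.2 hr')
    apply hn.ne_top
    rw [Ideal.eq_top_iff_one]
    have := sub_mem this hr
    simpa using this
  have h0 : N = ⊥ := Submodule.annihilator_eq_top_iff.1 hann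
  intro x hx
  have hx' : B.mkQ x ∈ N := Submodule.mem_map_of_mem hx
  rw [h0, Submodule.mem_bot] at hx'
  simpa using hx'

theorem exists_separating {A G : Type*} [CommRing A] [Group G] [Finite G] [MulSemiringAction G A]
    (n : Ideal A) (hn : n.IsMaximal) :
    ∃ a : A, a - 1 ∈ n ∧ ∀ g : G, ¬ StabIdeal n g → g • a ∈ n := by
  classical
  cases nonempty_fintype G
  have hex : ∀ g : G, ∃ c : A, c ∉ n ∧ (¬ StabIdeal n g → g • c ∈ n) := by
    intro g
    by_cases hg : StabIdeal n g
    · exact ⟨1, fun h => hn.ne_top ((Ideal.eq_top_iff_one _).2 h), fun h => absurd hg h⟩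
    · by_contra hcon
      push Not at hcon
      have hle : n.comap (MulSemiringAction.toRingHom G A g) ≤ n := by
        intro c hc
        by_contra hc'
        exact (hcon c hc').2 hc
      have hmax : (n.comap (MulSemiringAction.toRingHom G A g)).IsMaximal :=
        Ideal.comap_isMaximal_of_surjective _ (MulAction.surjective g)
      have := hmax.eq_of_le hn.ne_top hle
      apply hg
      intro a
      conv_rhs => rw [← this]
      rfl
  choose c hc hc' using hex
  have hprod : ∏ g : G, c g ∉ n := by
    rw [hn.isPrime.prod_mem_iff]
    push Not
    exact fun g _ => hc g
  obtain ⟨b, i, hi, hb⟩ := hn.exists_inv hprod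
  refine ⟨b * ∏ g : G, c g, ?_, fun g hg => ?_⟩
  · rw [← hb]; ring_nf; exact n.neg_mem hi
  · rw [smul_mul', Finset.smul_prod']
    refine n.mul_mem_left _ ?_
    rw [← Finset.mul_prod_erase _ _ (Finset.mem_univ g)]
    exact n.mul_mem_right _ (hc' g hg)

theorem exact_step {A G X0 X1 X2 : Type*} [CommRing A] [Group G] [Finite G] [MulSemiringAction G A]
    [AddCommGroup X0] [Module A X0] [AddCommGroup X1] [Module A X1] [AddCommGroup X2] [Module A X2]
    [DistribMulAction G X0] [DistribMulAction G X1] [DistribMulAction G X2]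
    (hN : ∀ m : ℕ, m ≠ 0 → IsUnit (m : A))
    (heq : ∀ (g : G) (a : A) (x : X1), g • (a • x) = (g • a) • (g • x))
    [Module.Finite A X1]
    (d0 : X0 →ₗ[A] X1) (d1 : X1 →ₗ[A] X2)
    (hd : ∀ x, d1 (d0 x) = 0)
    (hd1 : ∀ (g : G) x, d1 (g • x) = g • d1 x)
    (s : X2 →ₗ[A] X1) (hs : ∀ x, d1 (s (d1 x)) = d1 x)
    (ha : ∀ x, d1 x = 0 → (∀ g : G, g • x = x) → ∃ y, d0 y = x)
    (hb : ∀ n : Ideal A, n.IsMaximal → ∀ x : X1, d1 x ∈ n • (⊤ : Submodule A X2) →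
      x ∈ Submodule.span A {y : X1 | d1 y ∈ n • (⊤ : Submodule A X2) ∧
        ∀ g : G, StabIdeal n g → g • y - y ∈ LinearMap.range d0 ⊔ n • (⊤ : Submodule A X1)}) :
    ∀ x, d1 x = 0 → ∃ y, d0 y = x := by
  classical
  cases nonempty_fintype G
  let π : X1 →ₗ[A] X1 := LinearMap.id - s ∘ₗ d1
  have hπZ : ∀ x, d1 (π x) = 0 := fun x => by simp [π, hs]
  have hπ : ∀ x, d1 x = 0 → π x = x := fun x hx => by simp [π, hx]
  set Z := LinearMap.ker d1 with hZdef
  have hrange : Z = LinearMap.range π := by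
    ext x
    refine ⟨fun hx => ⟨x, hπ x hx⟩, ?_⟩
    rintro ⟨y, rfl⟩
    exact hπZ y
  have hZfg : Z.FG := by
    rw [hrange, LinearMap.range_eq_map]
    exact Module.Finite.fg_top.map _
  have key : Z ≤ LinearMap.range d0 := by
    refine le_of_forall_maximal _ _ hZfg fun n hn => ?_
    have hπn : ∀ x ∈ n • (⊤ : Submodule A X1), π x ∈ n • Z := fun x hx => by
      have : π x ∈ (n • (⊤ : Submodule A X1)).map π := Submodule.mem_map_of_mem hx
      rwa [Submodule.map_smul'', ← LinearMap.range_eq_map, ← hrange] at this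
    have hπB : ∀ x ∈ LinearMap.range d0 ⊔ n • (⊤ : Submodule A X1), π x ∈ LinearMap.range d0 ⊔ n • Z := by
      intro x hx
      obtain ⟨y, hy, z, hz, rfl⟩ := Submodule.mem_sup.1 hx
      rw [map_add]
      refine Submodule.add_mem_sup ?_ (hπn z hz)
      obtain ⟨w, rfl⟩ := hy
      rw [hπ _ (hd w)]
      exact ⟨w, rfl⟩
    obtain ⟨a, ha1, ha2⟩ := exists_separating (G := G) n hn
    intro z hz
    have hz' : z = π z := (hπ z hz).symm
    have hzs := hb n hn z (by rw [LinearMap.mem_ker.1 hz]; exact zero_mem _)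
    rw [hz']
    suffices hsp : Submodule.span A {y : X1 | d1 y ∈ n • (⊤ : Submodule A X2) ∧
        ∀ g : G, StabIdeal n g → g • y - y ∈ LinearMap.range d0 ⊔ n • (⊤ : Submodule A X1)} ≤
        (LinearMap.range d0 ⊔ n • Z).comap π from hsp hzs
    rw [Submodule.span_le]
    rintro y ⟨hy1, hy2⟩
    rw [SetLike.mem_coe, Submodule.mem_comap]
    have hsy : s (d1 y) ∈ n • (⊤ : Submodule A X1) := map_mem_smul_top s hy1
    have hw : ∀ g : G, g • π y ∈ Z := fun g => by
      rw [hZdef, LinearMap.mem_ker, hd1, hπZ, smul_zero]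
    have hgw : ∀ g : G, StabIdeal n g → g • π y - π y ∈ LinearMap.range d0 ⊔ n • Z := by
      intro g hg
      rw [← hπ _ (show d1 (g • π y - π y) = 0 from sub_mem (hw g) (hπZ y))]
      apply hπB
      have e : g • π y - π y = (g • y - y) - (g • s (d1 y) - s (d1 y)) := by
        simp only [π, LinearMap.sub_apply, LinearMap.id_apply, LinearMap.comp_apply, smul_sub]
        abel
      rw [e]
      exact sub_mem (hy2 g hg) (Submodule.mem_sup_right (sub_mem (smul_mem_smul_top heq hg hsy) hsy))
    have hw0 : ∑ g : G, g • (a • π y) ∈ LinearMap.range d0 := by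
      refine ha _ ?_ ?_
      · rw [map_sum]
        refine Finset.sum_eq_zero fun g _ => ?_
        rw [hd1, map_smul, hπZ, smul_zero, smul_zero]
      · intro h
        rw [Finset.smul_sum]
        exact Fintype.sum_equiv (Equiv.mulLeft h) _ _ fun g => by simp [mul_smul]
    have hdiff : ∑ g : G, g • (a • π y) - ∑ g : G, (if StabIdeal n g then π y else 0) ∈
        LinearMap.range d0 ⊔ n • Z := by
      rw [← Finset.sum_sub_distrib]
      refine sum_mem fun g _ => ?_
      rw [heq]
      split_ifs with hg
      · have e : (g • a) • g • π y - π y = (g • (a - 1)) • g • π y + (g • π y - π y) := by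
          rw [smul_sub, smul_one, sub_smul, one_smul]; abel
        rw [e]
        exact add_mem (Submodule.mem_sup_right (Submodule.smul_mem_smul ((hg _).2 ha1) (hw g))) (hgw g hg)
      · rw [sub_zero]
        exact Submodule.mem_sup_right (Submodule.smul_mem_smul (ha2 g hg) (hw g))
    have h3 := sub_mem (Submodule.mem_sup_left hw0) hdiff
    rw [sub_sub_cancel, ← Finset.sum_filter, Finset.sum_const, ← Nat.cast_smul_eq_nsmul A] at h3
    obtain ⟨u, hu⟩ := hN (Finset.univ.filter (StabIdeal (G := G) n)).card (by
      rw [Finset.card_ne_zero]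
      exact ⟨1, by simp [StabIdeal.one]⟩)
    rw [← hu] at h3
    exact (Submodule.smul_mem_iff_of_isUnit _ u.isUnit).1 h3
  exact fun x hx => key hx

theorem prod_mem_smul_top {A T E : Type*} [CommRing A] [AddCommGroup T] [Module A T]
    [AddCommGroup E] [Module A E] {n : Ideal A} {x : T × E} :
    x ∈ n • (⊤ : Submodule A (T × E)) ↔ x.1 ∈ n • (⊤ : Submodule A T) ∧ x.2 ∈ n • (⊤ : Submodule A E) := by
  constructor
  · intro h
    exact ⟨map_mem_smul_top (LinearMap.fst A T E) h, map_mem_smul_top (LinearMap.snd A T E) h⟩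
  · rintro ⟨h1, h2⟩
    have := add_mem (map_mem_smul_top (LinearMap.inl A T E) h1) (map_mem_smul_top (LinearMap.inr A T E) h2)
    simpa using this

/-- Differential of the mapping cone. -/
def coneD {A T1 T2 E0 E1 : Type*} [CommRing A] [AddCommGroup T1] [Module A T1] [AddCommGroup T2] [Module A T2]
    [AddCommGroup E0] [Module A E0] [AddCommGroup E1] [Module A E1]
    (dT : T1 →ₗ[A] T2) (dE : E0 →ₗ[A] E1) (φ : T1 →ₗ[A] E1) : (T1 × E0) →ₗ[A] (T2 × E1) :=
  LinearMap.prod (-(dT ∘ₗ LinearMap.fst A T1 E0))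
    (φ ∘ₗ LinearMap.fst A T1 E0 + dE ∘ₗ LinearMap.snd A T1 E0)

@[simp] theorem coneD_apply {A T1 T2 E0 E1 : Type*} [CommRing A] [AddCommGroup T1] [Module A T1] [AddCommGroup T2] [Module A T2]
    [AddCommGroup E0] [Module A E0] [AddCommGroup E1] [Module A E1]
    (dT : T1 →ₗ[A] T2) (dE : E0 →ₗ[A] E1) (φ : T1 →ₗ[A] E1) (x : T1 × E0) :
    coneD dT dE φ x = (- dT x.1, φ x.1 + dE x.2) := rfl

/-- The cone satisfies the fibre condition in the middle degree. -/
theorem cone_fiber {A G T0 T1 T2 E0 E1 E2 : Type*} [CommRing A] [Group G] [Finite G] [MulSemiringAction G A]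
    [AddCommGroup T0] [Module A T0] [AddCommGroup T1] [Module A T1] [AddCommGroup T2] [Module A T2]
    [AddCommGroup E0] [Module A E0] [AddCommGroup E1] [Module A E1] [AddCommGroup E2] [Module A E2]
    [DistribMulAction G T1] [DistribMulAction G T2] [DistribMulAction G E1] [DistribMulAction G E2]
    (hN : ∀ m : ℕ, m ≠ 0 → IsUnit (m : A))
    (heqT : ∀ (g : G) (a : A) (x : T1), g • (a • x) = (g • a) • (g • x))
    (heqT2 : ∀ (g : G) (a : A) (x : T2), g • (a • x) = (g • a) • (g • x))
    (heqE2 : ∀ (g : G) (a : A) (x : E2), g • (a • x) = (g • a) • (g • x))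
    (dT0 : T0 →ₗ[A] T1) (dT1 : T1 →ₗ[A] T2) (dE0 : E0 →ₗ[A] E1) (dE1 : E1 →ₗ[A] E2)
    (φ0 : T0 →ₗ[A] E1) (φ1 : T1 →ₗ[A] E2)
    (hdT : ∀ (g : G) x, dT1 (g • x) = g • dT1 x) (hdE : ∀ (g : G) x, dE1 (g • x) = g • dE1 x)
    (hφ : ∀ (g : G) x, φ1 (g • x) = g • φ1 x)
    (n : Ideal A) (hn : n.IsMaximal)
    (hI : ∀ g : G, (∀ a : A, g • a - a ∈ n) → ∀ t : T1, g • t - t ∈ n • (⊤ : Submodule A T1))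
    (hb : ∀ x : E1, dE1 x ∈ n • (⊤ : Submodule A E2) →
      x ∈ Submodule.span A {y : E1 | dE1 y ∈ n • (⊤ : Submodule A E2) ∧
        ∀ g : G, StabIdeal n g → g • y - y ∈ LinearMap.range dE0 ⊔ n • (⊤ : Submodule A E1)})
    (x : T1 × E1) (hx : coneD dT1 dE1 φ1 x ∈ n • (⊤ : Submodule A (T2 × E2))) :
    x ∈ Submodule.span A {y : T1 × E1 | coneD dT1 dE1 φ1 y ∈ n • (⊤ : Submodule A (T2 × E2)) ∧
        ∀ g : G, StabIdeal n g → g • y - y ∈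
          LinearMap.range (coneD dT0 dE0 φ0) ⊔ n • (⊤ : Submodule A (T1 × E1))} := by
  classical
  cases nonempty_fintype G
  set D := Submodule.span A {y : T1 × E1 | coneD dT1 dE1 φ1 y ∈ n • (⊤ : Submodule A (T2 × E2)) ∧
        ∀ g : G, StabIdeal n g → g • y - y ∈
          LinearMap.range (coneD dT0 dE0 φ0) ⊔ n • (⊤ : Submodule A (T1 × E1))} with hD
  have hDcoc : D ≤ (n • (⊤ : Submodule A (T2 × E2))).comap (coneD dT1 dE1 φ1) := by
    rw [hD, Submodule.span_le]
    rintro y ⟨hy, -⟩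
    exact hy
  have hinr : ∀ e : E1, dE1 e ∈ n • (⊤ : Submodule A E2) → ((0 : T1), e) ∈ D := by
    intro e he
    suffices h : Submodule.span A _ ≤ D.comap (LinearMap.inr A T1 E1) from h (hb e he)
    rw [Submodule.span_le]
    rintro y ⟨hy1, hy2⟩
    refine Submodule.subset_span ⟨?_, fun g hg => ?_⟩
    · rw [prod_mem_smul_top]; simpa using hy1
    · obtain ⟨_, ⟨w, rfl⟩, z, hz, h⟩ := Submodule.mem_sup.1 (hy2 g hg)
      have : g • (LinearMap.inr A T1 E1 y) - LinearMap.inr A T1 E1 y =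
          coneD dT0 dE0 φ0 (0, w) + (0, z) := by
        ext <;> simp [h]
      rw [this]
      refine Submodule.add_mem_sup ⟨_, rfl⟩ ?_
      rw [prod_mem_smul_top]
      simpa using hz
  let K : Submodule A T1 := (n • (⊤ : Submodule A T2)).comap dT1 ⊓
    (LinearMap.range dE1 ⊔ n • (⊤ : Submodule A E2)).comap φ1
  have hlem := lemT hN heqT n hn hI K
    (fun t ht => ⟨map_mem_smul_top dT1 ht, Submodule.mem_sup_right (map_mem_smul_top φ1 ht)⟩)
    (by
      rintro g hg t ⟨ht1, ht2⟩
      refine ⟨?_, ?_⟩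
      · rw [SetLike.mem_coe, Submodule.mem_comap, hdT]; exact smul_mem_smul_top heqT2 hg ht1
      · rw [SetLike.mem_coe, Submodule.mem_comap, hφ]
        obtain ⟨_, ⟨w, rfl⟩, z, hz, h⟩ := Submodule.mem_sup.1 (show φ1 t ∈ _ from ht2)
        rw [← h, smul_add, ← hdE]
        exact Submodule.add_mem_sup ⟨_, rfl⟩ (smul_mem_smul_top heqE2 hg hz))
  have hfst : K ≤ D.map (LinearMap.fst A T1 E1) := by
    refine hlem.trans ?_
    rw [Submodule.span_le]
    rintro t ⟨⟨ht1, ht2⟩, ht3⟩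
    obtain ⟨_, ⟨w, rfl⟩, z, hz, h⟩ := Submodule.mem_sup.1 (show φ1 t ∈ _ from ht2)
    set Γ := Finset.univ.filter (StabIdeal (G := G) n) with hΓ
    have hmem : ((Γ.card • t, - ∑ g ∈ Γ, g • w) : T1 × E1) ∈ D := by
      refine Submodule.subset_span ⟨?_, fun g hg => ?_⟩
      · rw [prod_mem_smul_top]
        refine ⟨?_, ?_⟩
        · simp only [coneD_apply, map_nsmul]
          exact neg_mem (Submodule.smul_of_tower_mem _ _ ht1)
        · simp only [coneD_apply, map_nsmul, map_neg, map_sum]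
          rw [← Finset.sum_const, ← sub_eq_add_neg, ← Finset.sum_sub_distrib]
          refine sum_mem fun g hg => ?_
          have hg' := (Finset.mem_filter.1 hg).2
          have e : φ1 t - dE1 (g • w) = g • z - φ1 (g • t - t) := by
            rw [map_sub, hφ, hdE, ← h, smul_add]; abel
          rw [e]
          exact sub_mem (smul_mem_smul_top heqE2 hg' hz) (map_mem_smul_top φ1 (ht3 g hg'))
      · apply Submodule.mem_sup_right
        rw [prod_mem_smul_top]
        refine ⟨?_, ?_⟩
        · simp only [Prod.fst_sub, Prod.smul_fst]
          rw [smul_comm, ← smul_sub]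
          exact Submodule.smul_of_tower_mem _ _ (ht3 g hg)
        · simp only [Prod.snd_sub, Prod.smul_snd]
          rw [smul_neg, sum_smul_invariant n g hg, sub_self]
          exact zero_mem _
    have h3 : (Γ.card : A) • t ∈ D.map (LinearMap.fst A T1 E1) := by
      rw [Nat.cast_smul_eq_nsmul]
      exact ⟨_, hmem, rfl⟩
    obtain ⟨u, hu⟩ := hN Γ.card (by
      rw [Finset.card_ne_zero]
      exact ⟨1, by simp [hΓ, StabIdeal.one]⟩)
    rw [← hu] at h3
    exact (Submodule.smul_mem_iff_of_isUnit _ u.isUnit).1 h3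
  obtain ⟨t, e⟩ := x
  rw [prod_mem_smul_top] at hx
  simp only [coneD_apply] at hx
  have htK : t ∈ K := by
    refine ⟨by simpa using neg_mem hx.1, ?_⟩
    rw [SetLike.mem_coe, Submodule.mem_comap]
    have : φ1 t = dE1 (-e) + (φ1 t + dE1 e) := by rw [map_neg]; abel
    rw [this]
    exact Submodule.add_mem_sup ⟨_, rfl⟩ hx.2
  obtain ⟨⟨t', e'⟩, hmem, rfl⟩ := hfst htK
  have hc := hDcoc hmem
  rw [Submodule.mem_comap, prod_mem_smul_top] at hc
  simp only [coneD_apply, LinearMap.fst_apply] at hc hx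
  have h4 := hinr (e - e') (by
    have := sub_mem hx.2 hc.2
    rw [map_sub]; simpa using this)
  have h5 := add_mem hmem h4
  simpa using h5


section Inv

variable (k : Type*) [Field k] (A : Type u) [CommRing A] [Algebra k A]
    (G : Type w) [Group G] [MulSemiringAction G A] [SMulCommClass G k A]

instance invAlg_smulCommClass : SMulCommClass ↥(invAlg k A G) G A where
  smul_comm r g a := by
    rw [Subalgebra.smul_def, Subalgebra.smul_def, smul_eq_mul, smul_eq_mul, smul_mul', r.2 g]

instance invAlg_isInvariant : Algebra.IsInvariant ↥(invAlg k A G) A G where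
  isInvariant a ha := ⟨⟨a, ha⟩, rfl⟩

theorem invAlg_finite [Finite G] [Algebra.FiniteType k A] : Module.Finite ↥(invAlg k A G) A := by
  have : Algebra.IsIntegral ↥(invAlg k A G) A := Algebra.IsInvariant.isIntegral _ _ G
  have : Algebra.FiniteType ↥(invAlg k A G) A := Algebra.FiniteType.of_restrictScalars_finiteType k _ _
  exact Algebra.IsIntegral.finite

theorem invAlg_noeth [Finite G] [Algebra.FiniteType k A] : IsNoetherianRing ↥(invAlg k A G) := by
  have hf := invAlg_finite k A G
  have : Algebra.FiniteType k ↥(invAlg k A G) := 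
    ⟨fg_of_fg_of_fg k ↥(invAlg k A G) A Algebra.FiniteType.out hf.fg_top Subtype.val_injective⟩
  exact Algebra.FiniteType.isNoetherianRing k _

variable {k A G}

theorem tensor_heq {P : Type*} [AddCommGroup P] [Module ↥(invAlg k A G) P] (g : G) (a : A)
    (x : A ⊗[↥(invAlg k A G)] P) : g • (a • x) = (g • a) • (g • x) := by
  induction x using TensorProduct.induction_on with
  | zero => simp
  | tmul b p => simp [TensorProduct.smul_tmul', smul_mul']
  | add x y hx hy => simp only [smul_add, hx, hy]

theorem tensor_inertia {P : Type*} [AddCommGroup P] [Module ↥(invAlg k A G) P] (n : Ideal A) (g : G)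
    (hg : ∀ a : A, g • a - a ∈ n) (t : A ⊗[↥(invAlg k A G)] P) :
    g • t - t ∈ n • (⊤ : Submodule A (A ⊗[↥(invAlg k A G)] P)) := by
  induction t using TensorProduct.induction_on with
  | zero => simp
  | tmul b p =>
    rw [TensorProduct.smul_tmul', ← TensorProduct.sub_tmul]
    have : (g • b - b) ⊗ₜ[↥(invAlg k A G)] p = (g • b - b) • ((1 : A) ⊗ₜ[↥(invAlg k A G)] p) := by
      rw [TensorProduct.smul_tmul', smul_eq_mul, mul_one]
    rw [this]
    exact Submodule.smul_mem_smul (hg b) Submodule.mem_top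
  | add x y hx hy =>
    have := add_mem hx hy
    rw [smul_add]; convert this using 1; abel

theorem tensor_inv [CharZero k] [Finite G] {P : Type*} [AddCommGroup P] [Module ↥(invAlg k A G) P]
    (t : A ⊗[↥(invAlg k A G)] P) (ht : ∀ g : G, g • t = t) : ∃ p : P, t = (1 : A) ⊗ₜ[↥(invAlg k A G)] p := by
  cases nonempty_fintype G
  have key : ∀ t : A ⊗[↥(invAlg k A G)] P, ∃ p : P, ∑ g : G, g • t = (1 : A) ⊗ₜ[↥(invAlg k A G)] p := by
    intro t
    induction t using TensorProduct.induction_on with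
    | zero => exact ⟨0, by simp⟩
    | tmul b p =>
      let r : ↥(invAlg k A G) := ⟨∑ g : G, g • b, fun h => by
        rw [Finset.smul_sum]
        exact Fintype.sum_equiv (Equiv.mulLeft h) _ _ fun g => by simp [mul_smul]⟩
      refine ⟨r • p, ?_⟩
      rw [← TensorProduct.smul_tmul, Subalgebra.smul_def, smul_eq_mul, mul_one]
      simp only [TensorProduct.smul_tmul', r, TensorProduct.sum_tmul]
    | add x y hx hy =>
      obtain ⟨p, hp⟩ := hx
      obtain ⟨q, hq⟩ := hy
      exact ⟨p + q, by simp only [smul_add, Finset.sum_add_distrib, hp, hq, TensorProduct.tmul_add]⟩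
  obtain ⟨p, hp⟩ := key t
  simp only [ht, Finset.sum_const, Finset.card_univ] at hp
  let c : k := (Fintype.card G : k)⁻¹
  refine ⟨algebraMap k ↥(invAlg k A G) c • p, ?_⟩
  have h1 : algebraMap k A c • (Fintype.card G • t) = t := by
    rw [← Nat.cast_smul_eq_nsmul A, smul_smul, ← map_natCast (algebraMap k A), ← map_mul,
      inv_mul_cancel₀, map_one, one_smul]
    exact_mod_cast Fintype.card_ne_zero
  rw [← TensorProduct.smul_tmul, ← h1, hp, TensorProduct.smul_tmul']
  rfl

theorem tensor_one_inj {P : Type*} [AddCommGroup P] [Module ↥(invAlg k A G) P]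
    [Module.Flat ↥(invAlg k A G) P] (p : P) (hp : (1 : A) ⊗ₜ[↥(invAlg k A G)] p = 0) : p = 0 := by
  have h := Module.Flat.rTensor_preserves_injective_linearMap (M := P)
    (Algebra.linearMap ↥(invAlg k A G) A) Subtype.val_injective
  have h2 : (1 : ↥(invAlg k A G)) ⊗ₜ[↥(invAlg k A G)] p = 0 := by
    apply h
    rw [map_zero, LinearMap.rTensor_tmul, Algebra.linearMap_apply, map_one, hp]
  have := congrArg (TensorProduct.lid _ _) h2
  simpa using this

theorem tensor_map_equivariant {P P' : Type*} [AddCommGroup P] [Module ↥(invAlg k A G) P]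
    [AddCommGroup P'] [Module ↥(invAlg k A G) P'] (f : P →ₗ[↥(invAlg k A G)] P') (g : G)
    (t : A ⊗[↥(invAlg k A G)] P) : f.baseChange A (g • t) = g • f.baseChange A t := by
  induction t using TensorProduct.induction_on with
  | zero => simp
  | tmul b p => simp [TensorProduct.smul_tmul']
  | add x y hx hy => simp only [smul_add, map_add, hx, hy]

theorem equivariant_of_tmul {P E : Type*} [AddCommGroup P] [Module ↥(invAlg k A G) P]
    [AddCommGroup E] [Module A E] [DistribMulAction G E] (φ : (A ⊗[↥(invAlg k A G)] P) →ₗ[A] E)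
    (h : ∀ (g : G) (a : A) (x : P), φ ((g • a) ⊗ₜ x) = g • φ (a ⊗ₜ x)) (g : G)
    (t : A ⊗[↥(invAlg k A G)] P) : φ (g • t) = g • φ t := by
  induction t using TensorProduct.induction_on with
  | zero => simp
  | tmul b p => rw [TensorProduct.smul_tmul', h]
  | add x y hx hy => simp only [smul_add, map_add, hx, hy]

end Inv

theorem contraction_all {A : Type*} [CommRing A] (X : ℤ → Type*) [∀ j, AddCommGroup (X j)] [∀ j, Module A (X j)]
    [∀ j, Module.Projective A (X j)]
    (d : ∀ i j : ℤ, i + 1 = j → (X i →ₗ[A] X j))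
    (hdd : ∀ (i j l : ℤ) (hij : i + 1 = j) (hjl : j + 1 = l) (x : X i), d j l hjl (d i j hij x) = 0)
    (b : ℤ) (hb : ∀ j, b < j → ∀ x : X j, x = 0)
    (step : ∀ (i j l : ℤ) (hij : i + 1 = j) (hjl : j + 1 = l),
      ∀ s : X l →ₗ[A] X j, (∀ x, d j l hjl (s (d j l hjl x)) = d j l hjl x) →
      ∀ x, d j l hjl x = 0 → ∃ y, d i j hij y = x) :
    ∀ (i j l : ℤ) (hij : i + 1 = j) (hjl : j + 1 = l),
      ∃ s : X j →ₗ[A] X i, ∀ x, d j l hjl x = 0 → d i j hij (s x) = x := by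
  have key : ∀ (m : ℕ) (i j l : ℤ) (hij : i + 1 = j) (hjl : j + 1 = l), b < j + m →
      ∃ s : X j →ₗ[A] X i, ∀ x, d j l hjl x = 0 → d i j hij (s x) = x := by
    intro m
    induction m with
    | zero =>
      intro i j l hij hjl hj
      refine ⟨0, fun x _ => ?_⟩
      rw [hb j (by simpa using hj) x, map_zero, map_zero]
    | succ m ih =>
      intro i j l hij hjl hj
      obtain ⟨s, hs⟩ := ih j l (l + 1) hjl rfl (by push_cast at hj; omega)
      have hs' : ∀ x, d j l hjl (s (d j l hjl x)) = d j l hjl x := fun x => hs _ (hdd _ _ _ _ _ x)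
      exact contraction_step _ _ s hs' (step i j l hij hjl s hs')
  intro i j l hij hjl
  exact key (b + 1 - j).toNat i j l hij hjl (by omega)

section Main

variable {k : Type*} [Field k] {A : Type u} [CommRing A] [Algebra k A]
    {G : Type w} [Group G] [MulSemiringAction G A] [SMulCommClass G k A]

theorem natCast_isUnit (k : Type*) [Field k] [CharZero k] (A : Type*) [CommRing A] [Algebra k A]
    (m : ℕ) (hm : m ≠ 0) : IsUnit (m : A) := by
  rw [← map_natCast (algebraMap k A)]
  exact (IsUnit.mk0 (m : k) (by exact_mod_cast hm)).map _

/-- Direction (1) → (2). -/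
theorem forward [CharZero k] [Finite G] (E : EqvModComplex.{u, w, v} A G)
    (hproj : ∀ j, Module.Projective A (E.X j))
    (b : ℤ) (hbdd : ∀ j, b < j → ∀ x : E.X j, x = 0)
    (Q : ModComplex.{u, v} ↥(invAlg k A G))
    (hQ : ∀ j, Module.Projective (invAlg k A G) (Q.X j))
    (b' : ℤ) (hQb : ∀ j, b' < j → ∀ x : Q.X j, x = 0)
    (φ : ∀ j : ℤ, (A ⊗[invAlg k A G] Q.X j) →ₗ[A] E.X j)
    (hφd : ∀ (i j : ℤ) (h : i + 1 = j) (t : A ⊗[invAlg k A G] Q.X i),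
          φ j ((Q.d i j h).baseChange A t) = E.d i j h (φ i t))
    (hφ : ∀ (j : ℤ) (g : G) (t : A ⊗[invAlg k A G] Q.X j), φ j (g • t) = g • φ j t)
    (hsurj : ∀ (i j l : ℤ) (hij : i + 1 = j) (hjl : j + 1 = l) (y : E.X j), E.d j l hjl y = 0 →
      ∃ t : A ⊗[invAlg k A G] Q.X j, (Q.d j l hjl).baseChange A t = 0 ∧
        ∃ b : E.X i, E.d i j hij b = y - φ j t)
    (hinj : ∀ (i j l : ℤ) (hij : i + 1 = j) (hjl : j + 1 = l) (t : A ⊗[invAlg k A G] Q.X j),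
      (Q.d j l hjl).baseChange A t = 0 → (∃ b : E.X i, E.d i j hij b = φ j t) →
      ∃ s : A ⊗[invAlg k A G] Q.X i, (Q.d i j hij).baseChange A s = t)
    (n : Ideal A) (hn : n.IsMaximal) (i j l : ℤ) (hij : i + 1 = j) (hjl : j + 1 = l) (x : E.X j)
    (hx : E.d j l hjl x ∈ n • (⊤ : Submodule A (E.X l))) :
    x ∈ Submodule.span A {y : E.X j | E.d j l hjl y ∈ n • (⊤ : Submodule A (E.X l)) ∧
        ∀ g : G, StabIdeal n g → g • y - y ∈ LinearMap.range (E.d i j hij) ⊔ n • (⊤ : Submodule A (E.X j))} := by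
  have hTT : ∀ (i j l : ℤ) (hij : i + 1 = j) (hjl : j + 1 = l) (t : A ⊗[invAlg k A G] Q.X i),
      (Q.d j l hjl).baseChange A ((Q.d i j hij).baseChange A t) = 0 := by
    intro i j l hij hjl t
    rw [← LinearMap.comp_apply, ← LinearMap.baseChange_comp]
    have : Q.d j l hjl ∘ₗ Q.d i j hij = 0 := LinearMap.ext fun x => Q.d_comp_d _ _ _ _ _ x
    rw [this]; simp
  have hcon := contraction_all (A := A) (fun j => (A ⊗[invAlg k A G] Q.X (j + 1)) × E.X j)
    (fun i j h => coneD ((Q.d (i + 1) (j + 1) (by omega)).baseChange A) (E.d i j h)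
      (h ▸ φ (i + 1)))
    (by
      rintro i j l rfl rfl ⟨t, e⟩
      simp [hTT, hφd, E.d_comp_d])
    (max b b')
    (by
      rintro j hj ⟨t, e⟩
      have hs : Subsingleton (Q.X (j + 1)) := ⟨fun x y => by
        rw [hQb _ (by omega) x, hQb _ (by omega) y]⟩
      rw [hbdd j (by omega) e, Subsingleton.elim t 0]; rfl)
    (by
      rintro i j l rfl rfl s hs ⟨t, e⟩ hte
      simp only [coneD_apply, Prod.mk_eq_zero, neg_eq_zero] at hte
      obtain ⟨s', hs'⟩ := hinj (i + 1) (i + 1 + 1) _ rfl rfl t hte.1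
        ⟨-e, by rw [map_neg]; exact (eq_neg_of_add_eq_zero_left hte.2).symm⟩
      obtain ⟨t', ht', b, hb⟩ := hsurj i (i + 1) _ rfl rfl (φ _ s' + e) (by
        rw [map_add, ← hφd, hs', hte.2])
      refine ⟨(t' - s', b), ?_⟩
      ext
      · simp [ht', hs']
      · simp only [coneD_apply, hb, map_sub]; abel)
  subst hij hjl
  obtain ⟨s, hs⟩ := hcon (i + 1) (i + 1 + 1) _ rfl rfl
  obtain ⟨s0, hs0⟩ := hcon i (i + 1) _ rfl rfl
  dsimp only at hs hs0 s s0
  set D := coneD ((Q.d (i + 1 + 1) (i + 1 + 1 + 1) rfl).baseChange A) (E.d (i + 1) (i + 1 + 1) rfl)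
      (φ (i + 1 + 1)) with hD
  set y := D (0, x) with hy
  have hyn : y ∈ n • (⊤ : Submodule A ((A ⊗[invAlg k A G] Q.X (i + 1 + 1 + 1)) × E.X (i + 1 + 1))) := by
    rw [prod_mem_smul_top]; simpa [hy, hD] using hx
  have hsy := map_mem_smul_top s hyn
  have hDs : D (s y) = y := hs y (by simp [hy, hD, E.d_comp_d])
  have h0 := hs0 ((0, x) - s y) (by rw [map_sub, hDs, hy, sub_self])
  set z := s0 ((0, x) - s y) with hz
  rw [prod_mem_smul_top] at hsy
  simp only [coneD_apply, Prod.ext_iff, Prod.fst_sub, Prod.snd_sub, zero_sub, neg_inj] at h0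
  have hxe : x = φ (i + 1) z.1 + (E.d i (i + 1) rfl z.2 + (s y).2) := by
    rw [← add_assoc, h0.2]; abel
  set S := Submodule.span A {y : E.X (i + 1) | E.d (i + 1) (i + 1 + 1) rfl y ∈ n • (⊤ : Submodule A (E.X (i + 1 + 1))) ∧
        ∀ g : G, StabIdeal n g → g • y - y ∈ LinearMap.range (E.d i (i + 1) rfl) ⊔ n • (⊤ : Submodule A (E.X (i + 1)))}
  rw [hxe]
  refine add_mem ?_ (add_mem ?_ ?_)
  · have hlem := lemT (G := G) (T := A ⊗[invAlg k A G] Q.X (i + 1)) (natCast_isUnit k A)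
      (tensor_heq (k := k)) n hn (tensor_inertia (k := k) n)
      ((n • (⊤ : Submodule A (A ⊗[invAlg k A G] Q.X (i + 1 + 1)))).comap
        ((Q.d (i + 1) (i + 1 + 1) rfl).baseChange A))
      (fun t ht => map_mem_smul_top _ ht)
      (fun g hg t ht => by
        rw [Submodule.mem_comap, tensor_map_equivariant]
        exact smul_mem_smul_top (tensor_heq (k := k)) hg ht)
    have hz1 := hlem (show z.1 ∈ _ by rw [Submodule.mem_comap, h0.1]; exact hsy.1)
    suffices h : Submodule.span A _ ≤ S.comap (φ (i + 1)) from h hz1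
    rw [Submodule.span_le]
    rintro t ⟨ht1, ht2⟩
    refine Submodule.subset_span ⟨?_, fun g hg => ?_⟩
    · rw [← hφd]
      exact map_mem_smul_top _ ht1
    · rw [← hφ, ← map_sub]
      exact Submodule.mem_sup_right (map_mem_smul_top _ (ht2 g hg))
  · refine Submodule.subset_span ⟨by rw [E.d_comp_d]; exact zero_mem _, fun g hg => ?_⟩
    rw [← E.d_equivariant, ← map_sub]
    exact Submodule.mem_sup_left ⟨_, rfl⟩
  · refine Submodule.subset_span ⟨map_mem_smul_top _ hsy.2, fun g hg => ?_⟩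
    exact Submodule.mem_sup_right (sub_mem (smul_mem_smul_top (E.equivariant _) hg hsy.2) hsy.2)

/-- Direction (2) → (1), given an invariant resolution. -/
theorem backward [CharZero k] [Finite G] (E : EqvModComplex.{u, w, v} A G)
    (hproj : ∀ j, Module.Projective A (E.X j)) (hfin : ∀ j, Module.Finite A (E.X j))
    (b : ℤ) (hbdd : ∀ j, b < j → ∀ x : E.X j, x = 0)
    (Q : ModComplex.{u, v} ↥(invAlg k A G))
    (hQ : ∀ j, Module.Projective (invAlg k A G) (Q.X j))
    (hQf : ∀ j, Module.Finite (invAlg k A G) (Q.X j))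
    (b' : ℤ) (hQb : ∀ j, b' < j → ∀ x : Q.X j, x = 0)
    (φ : ∀ j : ℤ, (A ⊗[invAlg k A G] Q.X j) →ₗ[A] E.X j)
    (hφd : ∀ (i j : ℤ) (h : i + 1 = j) (t : A ⊗[invAlg k A G] Q.X i),
          φ j ((Q.d i j h).baseChange A t) = E.d i j h (φ i t))
    (hφ : ∀ (j : ℤ) (g : G) (t : A ⊗[invAlg k A G] Q.X j), φ j (g • t) = g • φ j t)
    (hres : ∀ (i j l : ℤ) (hij : i + 1 = j) (hjl : j + 1 = l) (p : Q.X j) (e : E.X i),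
      Q.d j l hjl p = 0 → (∀ g : G, g • e = e) → φ j (1 ⊗ₜ p) = E.d i j hij e →
      ∃ x : Q.X i, Q.d i j hij x = p ∧ φ i (1 ⊗ₜ x) = e)
    (h2 : ∀ (n : Ideal A) (_ : n.IsMaximal) (i j l : ℤ) (hij : i + 1 = j) (hjl : j + 1 = l) (x : E.X j)
      (_ : E.d j l hjl x ∈ n • (⊤ : Submodule A (E.X l))),
      x ∈ Submodule.span A {y : E.X j | E.d j l hjl y ∈ n • (⊤ : Submodule A (E.X l)) ∧
        ∀ g : G, StabIdeal n g → g • y - y ∈ LinearMap.range (E.d i j hij) ⊔ n • (⊤ : Submodule A (E.X j))})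
    (i j l : ℤ) (hij : i + 1 = j) (hjl : j + 1 = l)
    (t : A ⊗[invAlg k A G] Q.X l) (e : E.X j) (ht : (Q.d l (l + 1) rfl).baseChange A t = 0)
    (hte : φ l t + E.d j l hjl e = 0) :
    ∃ (s : A ⊗[invAlg k A G] Q.X j) (f : E.X i),
      -(Q.d j l hjl).baseChange A s = t ∧ φ j s + E.d i j hij f = e := by
  have hTT : ∀ (i j l : ℤ) (hij : i + 1 = j) (hjl : j + 1 = l) (t : A ⊗[invAlg k A G] Q.X i),
      (Q.d j l hjl).baseChange A ((Q.d i j hij).baseChange A t) = 0 := by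
    intro i j l hij hjl t
    rw [← LinearMap.comp_apply, ← LinearMap.baseChange_comp]
    have : Q.d j l hjl ∘ₗ Q.d i j hij = 0 := LinearMap.ext fun x => Q.d_comp_d _ _ _ _ _ x
    rw [this]; simp
  have hcon := contraction_all (A := A) (fun j => (A ⊗[invAlg k A G] Q.X (j + 1)) × E.X j)
    (fun i j h => coneD ((Q.d (i + 1) (j + 1) (by omega)).baseChange A) (E.d i j h)
      (h ▸ φ (i + 1)))
    (by
      rintro i j l rfl rfl ⟨t, e⟩
      simp [hTT, hφd, E.d_comp_d])
    (max b b')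
    (by
      rintro j hj ⟨t, e⟩
      have hs : Subsingleton (Q.X (j + 1)) := ⟨fun x y => by
        rw [hQb _ (by omega) x, hQb _ (by omega) y]⟩
      rw [hbdd j (by omega) e, Subsingleton.elim t 0]; rfl)
    (by
      rintro i j l rfl rfl s hs
      refine exact_step (G := G) (natCast_isUnit k A) ?_ _ _ ?_ ?_ s hs ?_ ?_
      · rintro g a ⟨t, e⟩
        ext
        · exact tensor_heq (k := k) g a t
        · exact E.equivariant _ g a e
      · rintro ⟨t, e⟩
        simp [hTT, hφd, E.d_comp_d]
      · rintro g ⟨t, e⟩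
        ext
        · simp [tensor_map_equivariant]
        · simp [hφ, E.d_equivariant]
      · rintro ⟨t, e⟩ hte hinv
        simp only [coneD_apply, Prod.mk_eq_zero, neg_eq_zero] at hte
        have ht : ∀ g : G, g • t = t := fun g => congrArg Prod.fst (hinv g)
        have he : ∀ g : G, g • e = e := fun g => congrArg Prod.snd (hinv g)
        obtain ⟨p, rfl⟩ := tensor_inv (k := k) t ht
        obtain ⟨x, hx1, hx2⟩ := hres (i + 1) (i + 1 + 1) _ rfl rfl p (-e)
          (tensor_one_inj (k := k) (A := A) (G := G) _ (by simpa using hte.1))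
          (fun g => by rw [smul_neg, he])
          (by rw [map_neg]; exact eq_neg_of_add_eq_zero_left hte.2)
        refine ⟨(- (1 ⊗ₜ x), 0), ?_⟩
        ext
        · simp [hx1]
        · simp [hx2]
      · intro n hn
        exact cone_fiber (G := G) (natCast_isUnit k A) (tensor_heq (k := k)) (tensor_heq (k := k))
          (E.equivariant _) _ _ _ _ _ _ (tensor_map_equivariant (k := k) _) (E.d_equivariant _ _ _) (hφ _) n hn (tensor_inertia (k := k) n)
          (h2 n hn i (i + 1) _ rfl rfl))
  subst hij hjl
  obtain ⟨s0, hs0⟩ := hcon i (i + 1) _ rfl rfl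
  have h0 := hs0 (t, e) (by simp [ht, hte])
  refine ⟨(s0 (t, e)).1, (s0 (t, e)).2, ?_, ?_⟩
  · exact congrArg Prod.fst h0
  · exact congrArg Prod.snd h0

end Main

section Resolution

variable (k : Type*) [Field k] {A : Type u} [CommRing A] [Algebra k A]
    {G : Type w} [Group G] [MulSemiringAction G A] [SMulCommClass G k A]

/-- One stage of the free resolution of the invariants of `E`. -/
structure ResState (E : EqvModComplex.{u, w, v} A G) (j : ℤ) where
  P : Type v
  [acg : AddCommGroup P]
  [mod : Module ↥(invAlg k A G) P]
  [proj : Module.Projective ↥(invAlg k A G) P]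
  [fin : Module.Finite ↥(invAlg k A G) P]
  K : Submodule ↥(invAlg k A G) P
  φ : P →ₗ[↥(invAlg k A G)] E.X j
  inv : ∀ (g : G) (p : P), g • φ p = φ p

attribute [instance] ResState.acg ResState.mod ResState.proj ResState.fin

/-- Compatibility of consecutive stages. -/
def ResRel {E : EqvModComplex.{u, w, v} A G} (i j : ℤ) (h : i + 1 = j) (s : ResState k E i)
    (t : ResState k E j) : Prop :=
  ∃ δ : s.P →ₗ[↥(invAlg k A G)] t.P, (∀ x, δ x ∈ t.K) ∧ (∀ x, t.φ (δ x) = E.d i j h (s.φ x)) ∧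
    s.K = LinearMap.ker δ ∧
    ∀ p ∈ t.K, ∀ e : E.X i, (∀ g : G, g • e = e) → t.φ p = E.d i j h e → ∃ x, δ x = p ∧ s.φ x = e

/-- The zero stage. -/
def zeroState (E : EqvModComplex.{u, w, v} A G) (j : ℤ) : ResState k E j where
  P := PUnit
  K := ⊤
  φ := 0
  inv g p := by simp

theorem exists_cover {R : Type u} [CommRing R] [Small.{v} R] (N : Type*) [AddCommGroup N] [Module R N]
    [Module.Finite R N] : ∃ (P : Type v) (_ : AddCommGroup P) (_ : Module R P) (_ : Module.Projective R P)
      (_ : Module.Finite R P) (f : P →ₗ[R] N), Function.Surjective f := by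
  obtain ⟨m, f, hf⟩ := Module.Finite.exists_fin' R N
  let e : Shrink.{v} (Fin m → R) ≃ₗ[R] (Fin m → R) := Shrink.linearEquiv R _
  refine ⟨Shrink.{v} (Fin m → R), inferInstance, inferInstance, Module.Projective.of_equiv e.symm,
    Module.Finite.equiv e.symm, f ∘ₗ e.toLinearMap, hf.comp e.surjective⟩

theorem exists_step [Finite G] [Algebra.FiniteType k A] [Small.{v} ↥(invAlg k A G)]
    (E : EqvModComplex.{u, w, v} A G) (hfin : ∀ j, Module.Finite A (E.X j))
    (i j : ℤ) (h : i + 1 = j) (t : ResState k E j) : ∃ s : ResState k E i, ResRel k i j h s t := by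
  have := invAlg_noeth k A G
  have := invAlg_finite k A G
  have : ∀ j, Module.Finite ↥(invAlg k A G) (E.X j) := fun j => Module.Finite.trans A _
  let N : Submodule ↥(invAlg k A G) (t.P × E.X i) :=
    { carrier := {x | x.1 ∈ t.K ∧ t.φ x.1 = E.d i j h x.2 ∧ ∀ g : G, g • x.2 = x.2}
      add_mem' := by
        rintro x y ⟨h1, h2, h3⟩ ⟨h1', h2', h3'⟩
        refine ⟨add_mem h1 h1', ?_, fun g => ?_⟩
        · simp [h2, h2']
        · simp [h3, h3']
      zero_mem' := ⟨zero_mem _, by simp, fun g => by simp⟩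
      smul_mem' := by
        rintro r x ⟨h1, h2, h3⟩
        refine ⟨Submodule.smul_mem _ _ h1, ?_, fun g => ?_⟩
        · simp only [Prod.smul_fst, Prod.smul_snd, map_smul, h2, Subalgebra.smul_def]
        · simp only [Prod.smul_snd, Subalgebra.smul_def]
          rw [E.equivariant, h3, r.2 g] }
  obtain ⟨P, _, _, _, _, f, hf⟩ := exists_cover.{u, v} (R := ↥(invAlg k A G)) N
  let F := N.subtype ∘ₗ f
  have hF : ∀ x, F x ∈ N := fun x => (f x).2
  let δ := LinearMap.fst _ _ _ ∘ₗ F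
  refine ⟨{ P := P, K := LinearMap.ker δ, φ := LinearMap.snd _ _ _ ∘ₗ F,
            inv := fun g p => (hF p).2.2 g }, δ, fun x => (hF x).1, fun x => (hF x).2.1, rfl, ?_⟩
  intro p hp e he hpe
  obtain ⟨x, hx⟩ := hf ⟨(p, e), hp, hpe, he⟩
  have hx' : F x = (p, e) := congrArg Subtype.val hx
  exact ⟨x, congrArg Prod.fst hx', congrArg Prod.snd hx'⟩

theorem exists_resolution [Finite G] [Algebra.FiniteType k A] [Small.{v} ↥(invAlg k A G)]
    (E : EqvModComplex.{u, w, v} A G) (hfin : ∀ j, Module.Finite A (E.X j))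
    (b : ℤ) (hbdd : ∀ j, b < j → ∀ x : E.X j, x = 0) :
    ∃ f : ∀ j, ResState k E j, (∀ i j h, ResRel k i j h (f i) (f j)) ∧
      ∀ j, b < j → ∀ x : (f j).P, x = 0 := by
  have hstep : ∀ (j : ℤ) (t : ResState k E j), ∃ s : ResState k E (j - 1), ResRel k (j - 1) j (by omega) s t :=
    fun j t => exists_step k E hfin _ _ _ t
  choose st hst using hstep
  let f : ∀ j, ResState k E j := fun j =>
    Int.inductionOn' (motive := fun j => ResState k E j) j (b + 1) (zeroState k E _)
      (fun m _ _ => zeroState k E (m + 1)) (fun m _ s => st m s)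
  have hf0 : ∀ j, b < j → f j = zeroState k E j := by
    intro j hj
    by_cases hjb : j = b + 1
    · subst hjb
      exact Int.inductionOn'_self
    · obtain ⟨m, rfl⟩ : ∃ m, j = m + 1 := ⟨j - 1, by omega⟩
      exact Int.inductionOn'_add_one (by omega)
  have hf1 : ∀ j, j ≤ b + 1 → f (j - 1) = st j (f j) := fun j hj => Int.inductionOn'_sub_one hj
  refine ⟨f, ?_, ?_⟩
  · intro i j h
    obtain rfl : i = j - 1 := by omega
    by_cases hj : j ≤ b + 1
    · rw [hf1 j hj]
      exact hst j (f j)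
    · rw [hf0 j (by omega), hf0 (j - 1) (by omega)]
      refine ⟨0, fun x => trivial, fun x => ?_, ?_, ?_⟩
      · exact (map_zero (E.d (j - 1) j h)).symm
      · exact LinearMap.ker_zero.symm
      · intro p hp e he hpe
        exact ⟨0, rfl, (hbdd (j - 1) (by omega) e).symm⟩
  · intro j hj
    rw [hf0 j hj]
    intro x
    rfl

theorem small_of_nontrivial [Algebra.FiniteType k A] (M : Type v) [AddCommGroup M] [Module A M] (x : M) (hx : x ≠ 0) :
    Small.{v} A := by
  let _ : Module k M := Module.compHom M (algebraMap k A)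
  have hk : Small.{v} k := by
    refine small_of_injective (f := fun c : k => (c • x : M)) ?_
    exact smul_left_injective k hx
  obtain ⟨m, f, hf⟩ := Algebra.FiniteType.iff_quotient_mvPolynomial''.1 (inferInstance : Algebra.FiniteType k A)
  have : Small.{v} (MvPolynomial (Fin m) k) := by
    have e : MvPolynomial (Fin m) k ≃ MvPolynomial (Fin m) (Shrink.{v} k) :=
      (MvPolynomial.mapEquiv (Fin m) (Shrink.ringEquiv k).symm).toEquiv
    exact small_map e
  exact small_of_surjective hf

theorem backward_full [CharZero k] [Finite G] [Algebra.FiniteType k A] [Small.{v} ↥(invAlg k A G)]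
    (E : EqvModComplex.{u, w, v} A G)
    (hproj : ∀ j, Module.Projective A (E.X j)) (hfin : ∀ j, Module.Finite A (E.X j))
    (b : ℤ) (hbdd : ∀ j, b < j → ∀ x : E.X j, x = 0)
    (h2 : ∀ (n : Ideal A) (_ : n.IsMaximal) (i j l : ℤ) (hij : i + 1 = j) (hjl : j + 1 = l) (x : E.X j)
      (_ : E.d j l hjl x ∈ n • (⊤ : Submodule A (E.X l))),
      x ∈ Submodule.span A {y : E.X j | E.d j l hjl y ∈ n • (⊤ : Submodule A (E.X l)) ∧
        ∀ g : G, StabIdeal n g → g • y - y ∈ LinearMap.range (E.d i j hij) ⊔ n • (⊤ : Submodule A (E.X j))}) :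
    ∃ Q : ModComplex.{u, v} ↥(invAlg k A G),
      (∀ j, Module.Projective (invAlg k A G) (Q.X j)) ∧
      (∀ j, b < j → ∀ x : Q.X j, x = 0) ∧
      ∃ φ : ∀ j : ℤ, (A ⊗[invAlg k A G] Q.X j) →ₗ[A] E.X j,
        (∀ (i j : ℤ) (h : i + 1 = j) (t : A ⊗[invAlg k A G] Q.X i),
          φ j ((Q.d i j h).baseChange A t) = E.d i j h (φ i t)) ∧
        (∀ (j : ℤ) (g : G) (a : A) (x : Q.X j),
          φ j ((g • a) ⊗ₜ x) = g • φ j (a ⊗ₜ x)) ∧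
        (∀ (i j l : ℤ) (hij : i + 1 = j) (hjl : j + 1 = l)
          (t : A ⊗[invAlg k A G] Q.X l) (e : E.X j), (Q.d l (l + 1) rfl).baseChange A t = 0 →
          φ l t + E.d j l hjl e = 0 →
          ∃ (s : A ⊗[invAlg k A G] Q.X j) (f : E.X i),
            -(Q.d j l hjl).baseChange A s = t ∧ φ j s + E.d i j hij f = e) := by
  obtain ⟨f, hrel, hz⟩ := exists_resolution k E hfin b hbdd
  choose δ h1 h2' h3 h4 using hrel
  let Q : ModComplex.{u, v} ↥(invAlg k A G) :=
    { X := fun j => (f j).P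
      d := δ
      d_comp_d := fun i j l hij hjl x => by
        have := h1 i j hij x
        rwa [h3 j l hjl] at this }
  let φ : ∀ j : ℤ, (A ⊗[invAlg k A G] Q.X j) →ₗ[A] E.X j := fun j => (f j).φ.liftBaseChange A
  have hφ1 : ∀ j (a : A) (x : Q.X j), φ j (a ⊗ₜ x) = a • (f j).φ x := fun j a x =>
    LinearMap.liftBaseChange_tmul _ _ _ _
  have hφd : ∀ (i j : ℤ) (h : i + 1 = j) (t : A ⊗[invAlg k A G] Q.X i),
          φ j ((Q.d i j h).baseChange A t) = E.d i j h (φ i t) := by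
    intro i j h t
    induction t using TensorProduct.induction_on with
    | zero => simp
    | tmul a x =>
      rw [LinearMap.baseChange_tmul, hφ1, hφ1, map_smul]
      exact congrArg _ (h2' i j h x)
    | add x y hx hy => simp only [map_add, hx, hy]
  have hφ2 : ∀ (j : ℤ) (g : G) (a : A) (x : Q.X j), φ j ((g • a) ⊗ₜ x) = g • φ j (a ⊗ₜ x) := by
    intro j g a x
    rw [hφ1, hφ1, E.equivariant, (f j).inv]
  have hQ : ∀ j, Module.Projective (invAlg k A G) (Q.X j) := fun j => (f j).proj
  refine ⟨Q, hQ, hz, φ, hφd, hφ2, ?_⟩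
  refine backward E hproj hfin b hbdd Q hQ (fun j => (f j).fin) b hz φ hφd
    (fun j => equivariant_of_tmul _ (hφ2 j)) ?_ h2
  intro i j l hij hjl p e hp he hpe
  rw [hφ1, one_smul] at hpe
  obtain ⟨x, hx1, hx2⟩ := h4 i j hij p (by rw [h3 j l hjl]; exact hp) e he hpe
  exact ⟨x, hx1, by rw [hφ1, one_smul]; exact hx2⟩

end Resolution

/-- **Descent criterion for equivariant complexes** (affine finite-group
case): `E` is equivariantly quasi-isomorphic to a complex pulled back from
`Spec Aᴳ` iff all cohomology modules of all fibers of `E` at maximal ideals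
are generated by stabilizer-fixed elements. -/
theorem complex_descends_iff_fiber_cohomology_generated_by_invariants
    (k : Type*) [Field k] [CharZero k]
    (A : Type u) [CommRing A] [Algebra k A] [Algebra.FiniteType k A]
    (G : Type w) [Group G] [Finite G] [MulSemiringAction G A] [SMulCommClass G k A]
    (E : EqvModComplex.{u, w, v} A G)
    (hproj : ∀ j, Module.Projective A (E.X j))
    (hfin : ∀ j, Module.Finite A (E.X j))
    (hbdd : ∃ b : ℤ, ∀ j, b < j → ∀ x : E.X j, x = 0) :
    (∃ Q : ModComplex.{u, v} ↥(invAlg k A G),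
      (∀ j, Module.Projective (invAlg k A G) (Q.X j)) ∧
      (∃ b : ℤ, ∀ j, b < j → ∀ x : Q.X j, x = 0) ∧
      ∃ φ : ∀ j : ℤ, (A ⊗[invAlg k A G] Q.X j) →ₗ[A] E.X j,
        -- `φ` is a chain map from `A ⊗[Aᴳ] Q` to `E`
        (∀ (i j : ℤ) (h : i + 1 = j) (t : A ⊗[invAlg k A G] Q.X i),
          φ j ((Q.d i j h).baseChange A t) = E.d i j h (φ i t)) ∧
        -- `φ` is `G`-equivariant (`G` acting through the factor `A`)
        (∀ (j : ℤ) (g : G) (a : A) (x : Q.X j),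
          φ j ((g • a) ⊗ₜ x) = g • φ j (a ⊗ₜ x)) ∧
        -- `φ` is a quasi-isomorphism: surjective on cohomology ...
        (∀ (j : ℤ) (y : E.X j), E.d j (j+1) rfl y = 0 →
          ∃ t : A ⊗[invAlg k A G] Q.X j, (Q.d j (j+1) rfl).baseChange A t = 0 ∧
            ∃ b : E.X (j-1), E.d (j-1) j (by omega) b = y - φ j t) ∧
        -- ... and injective on cohomology
        (∀ (j : ℤ) (t : A ⊗[invAlg k A G] Q.X j),
          (Q.d j (j+1) rfl).baseChange A t = 0 →
          (∃ b : E.X (j-1), E.d (j-1) j (by omega) b = φ j t) →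
          ∃ s : A ⊗[invAlg k A G] Q.X (j-1),
            (Q.d (j-1) j (by omega)).baseChange A s = t))
    ↔
    (∀ n : Ideal A, n.IsMaximal → ∀ (j : ℤ) (x : E.X j),
      E.d j (j+1) rfl x ∈ n • (⊤ : Submodule A (E.X (j+1))) →
      x ∈ Submodule.span A {y : E.X j |
        E.d j (j+1) rfl y ∈ n • (⊤ : Submodule A (E.X (j+1))) ∧
        ∀ g : G, (∀ a : A, g • a ∈ n ↔ a ∈ n) →
          g • y - y ∈ LinearMap.range (E.d (j-1) j (by omega)) ⊔
            n • (⊤ : Submodule A (E.X j))}) := by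
  obtain ⟨b, hb⟩ := hbdd
  constructor
  · rintro ⟨Q, hQ, ⟨b', hQb⟩, φ, hφd, hφ, hsurj, hinj⟩ n hn j x hx
    refine forward E hproj b hb Q hQ b' hQb φ hφd (fun j => equivariant_of_tmul _ (hφ j)) ?_ ?_
      n hn (j - 1) j (j + 1) (by omega) rfl x hx
    · intro i j l hij hjl y hy
      obtain rfl : i = j - 1 := by omega
      subst hjl
      exact hsurj j y hy
    · intro i j l hij hjl t ht hb
      obtain rfl : i = j - 1 := by omega
      subst hjl
      exact hinj j t ht hb
  · intro h2
    by_cases hE : ∀ j (x : E.X j), x = 0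
    · refine ⟨{ X := fun _ => PUnit, d := fun _ _ _ => 0, d_comp_d := fun _ _ _ _ _ _ => rfl },
        fun j => ?_, ⟨0, fun j _ x => rfl⟩, fun j => 0, ?_, ?_, ?_, ?_⟩
      · dsimp only; infer_instance
      · intro i j h t
        simp
      · intro j g a x
        simp
      · intro j y hy
        exact ⟨0, by simp, 0, by rw [hE j y]; simp⟩
      · intro j t _ _
        exact ⟨0, by rw [map_zero]; exact (Subsingleton.elim (α := A ⊗[invAlg k A G] PUnit.{v + 1}) _ _)⟩
    · push Not at hE
      obtain ⟨j₀, x₀, hx₀⟩ := hE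
      have hA : Small.{v} A := small_of_nontrivial k _ x₀ hx₀
      have hR : Small.{v} ↥(invAlg k A G) := small_of_injective Subtype.val_injective
      obtain ⟨Q, hQ, hQb, φ, hφd, hφ, hex⟩ := backward_full k E hproj hfin b hb (by
        intro n hn i j l hij hjl x hx
        obtain rfl : i = j - 1 := by omega
        subst hjl
        exact h2 n hn j x hx)
      refine ⟨Q, hQ, ⟨b, hQb⟩, φ, hφd, hφ, ?_, ?_⟩
      · intro j y hy
        obtain ⟨s, f, hs, hf⟩ := hex (j - 1) j (j + 1) (by omega) rfl 0 y (by simp) (by simp [hy])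
        exact ⟨s, neg_eq_zero.1 hs, f, by rw [← hf]; abel⟩
      · rintro j t ht ⟨e, he⟩
        obtain ⟨s, f, hs, hf⟩ := hex (j - 1 - 1) (j - 1) j (by omega) (by omega) t (-e) ht
          (by rw [map_neg, he, add_neg_cancel])
        exact ⟨-s, by rw [map_neg, hs]⟩
end
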